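/- arXiv:1411.5871 — 4 statements merged into one kernel-verified Lean document; each statement's English description precedes it below -/
import Mathlib

section
/- There exist polynomials P, Q ∈ ℝ[X] of degree at most 3 such that for all x ∈ (0,1): F_2(x) = −x^4·F_2(T(x)) − (π^3/3)·x·log(x) + P(x) − 6·∫_0^x t^2·(x−2t)·F_2(T(t)) dt, and G_2(x) = x^4·G_2(T(x)) − π^2·x^2·log(x) + Q(x) + 6·∫_0^x t^2·(x−2t)·G_2(T(t)) dt. -/
open Real

noncomputable section

/-- The sum-of-divisors function `σ₁(n) = ∑_{d ∣ n} d`. -/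
def sigma1 (n : ℕ) : ℕ := ∑ d ∈ n.divisors, d

/-- `F₂(x) = ∑_{n=1}^∞ σ₁(n)/n³ · sin(2πnx)`. -/
def F2 (x : ℝ) : ℝ :=
  ∑' n : ℕ, (sigma1 (n + 1) : ℝ) / ((n : ℝ) + 1) ^ 3 * Real.sin (2 * π * ((n : ℝ) + 1) * x)

/-- `G₂(x) = ∑_{n=1}^∞ σ₁(n)/n³ · cos(2πnx)`. -/
def G2 (x : ℝ) : ℝ :=
  ∑' n : ℕ, (sigma1 (n + 1) : ℝ) / ((n : ℝ) + 1) ^ 3 * Real.cos (2 * π * ((n : ℝ) + 1) * x)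

/-- The Gauss map: `T 0 = 0` and `T y = 1/y mod 1` otherwise. -/
def gauss (y : ℝ) : ℝ := if y = 0 then 0 else Int.fract y⁻¹

lemma sigma1_eq_sigma (n : ℕ) : sigma1 n = ArithmeticFunction.sigma 1 n := by
  rw [ArithmeticFunction.sigma_one_apply, sigma1]

/-- The Dirichlet coefficient `σ₁(n+1)/(n+1)³` as a real number. -/
def sigmaCoeff (n : ℕ) : ℝ := (sigma1 (n + 1) : ℝ) / ((n : ℝ) + 1) ^ 3

lemma sigmaCoeff_nonneg (n : ℕ) : 0 ≤ sigmaCoeff n := by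
  unfold sigmaCoeff
  positivity

lemma sigmaCoeff_le_one (n : ℕ) : sigmaCoeff n ≤ 1 := by
  unfold sigmaCoeff
  have h : (sigma1 (n + 1) : ℝ) ≤ ((n : ℝ) + 1) ^ 2 := by
    rw [sigma1_eq_sigma]
    exact_mod_cast ArithmeticFunction.sigma_le_pow_succ 1 (n + 1)
  rw [div_le_one (by positivity)]
  have : (1 : ℝ) ≤ (n : ℝ) + 1 := by simp
  exact h.trans (pow_le_pow_right₀ this (by norm_num))

lemma summable_sigmaCoeff : Summable sigmaCoeff := by
  have h1 : LSeriesSummable (fun n ↦ ((ArithmeticFunction.zeta : ArithmeticFunction ℂ) n)) 3 := by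
    have := (ArithmeticFunction.LSeriesSummable_zeta_iff (s := 3)).2 (by norm_num)
    simpa using this
  have h2 : LSeriesSummable
      (fun n ↦ (((ArithmeticFunction.pow 1 : ArithmeticFunction ℕ) : ArithmeticFunction ℂ) n))
      3 := by
    refine LSeriesSummable_of_le_const_mul_rpow (x := 2) (by norm_num) ⟨1, fun n hn ↦ ?_⟩
    norm_num [hn]
  have h3 := (summable_nat_add_iff 1).2 (ArithmeticFunction.LSeriesSummable_mul h1 h2).norm
  refine h3.congr fun n ↦ ?_
  have h4 : (ArithmeticFunction.zeta : ArithmeticFunction ℂ) *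
      ((ArithmeticFunction.pow 1 : ArithmeticFunction ℕ) : ArithmeticFunction ℂ)
      = ((ArithmeticFunction.sigma 1 : ArithmeticFunction ℕ) : ArithmeticFunction ℂ) := by
    rw [← ArithmeticFunction.zeta_mul_pow_eq_sigma]
    push_cast
    rfl
  rw [h4, LSeries.term_of_ne_zero (by simp), sigmaCoeff, sigma1_eq_sigma, norm_div]
  norm_num
  norm_cast

/-- The `n`-th term of the `k`-th derivative of `∑ σ₁(n) n⁻³ e(nz)`. -/
def eichlerTerm (k n : ℕ) (z : ℂ) : ℂ :=
  (sigmaCoeff n : ℂ) * (2 * π * Complex.I * ((n : ℂ) + 1)) ^ k *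
    Complex.exp (2 * π * Complex.I * ((n : ℂ) + 1) * z)

/-- The `k`-th derivative of `∑ σ₁(n) n⁻³ e(nz)`, defined as a termwise derivative. -/
def eichler (k : ℕ) (z : ℂ) : ℂ := ∑' n, eichlerTerm k n z

lemma hasDerivAt_eichlerTerm (k n : ℕ) (z : ℂ) :
    HasDerivAt (eichlerTerm k n) (eichlerTerm (k + 1) n z) z := by
  have h := (((hasDerivAt_id z).const_mul (2 * π * Complex.I * ((n : ℂ) + 1))).cexp).const_mul
    ((sigmaCoeff n : ℂ) * (2 * π * Complex.I * ((n : ℂ) + 1)) ^ k)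
  refine h.congr_deriv ?_
  simp only [eichlerTerm, id]
  ring

lemma norm_exp_two_pi_mul (n : ℕ) (z : ℂ) :
    ‖Complex.exp (2 * π * Complex.I * ((n : ℂ) + 1) * z)‖
      = Real.exp (-(2 * π * z.im)) ^ (n + 1) := by
  rw [Complex.norm_exp, ← Real.exp_nat_mul]
  congr 1
  simp
  ring

lemma norm_eichlerTerm (k n : ℕ) (z : ℂ) :
    ‖eichlerTerm k n z‖
      = sigmaCoeff n * (2 * π * ((n : ℝ) + 1)) ^ k * Real.exp (-(2 * π * z.im)) ^ (n + 1) := by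
  have h : ‖((n : ℂ) + 1)‖ = (n : ℝ) + 1 := by
    exact_mod_cast Complex.norm_natCast (n + 1)
  rw [eichlerTerm, norm_mul, norm_exp_two_pi_mul, norm_mul, norm_pow, norm_mul, h]
  simp [abs_of_nonneg (sigmaCoeff_nonneg n), abs_of_pos Real.pi_pos]

lemma norm_eichlerTerm_le (k n : ℕ) {δ : ℝ} {z : ℂ} (hz : δ ≤ z.im) :
    ‖eichlerTerm k n z‖
      ≤ (2 * π) ^ k * (((n + 1 : ℕ) : ℝ) ^ k * Real.exp (-(2 * π * δ)) ^ (n + 1)) := by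
  rw [norm_eichlerTerm]
  have h : Real.exp (-(2 * π * z.im)) ≤ Real.exp (-(2 * π * δ)) := by gcongr
  calc _ ≤ 1 * (2 * π * ((n : ℝ) + 1)) ^ k * Real.exp (-(2 * π * δ)) ^ (n + 1) := by
        gcongr
        exact sigmaCoeff_le_one n
    _ = _ := by
      push_cast
      rw [mul_pow]
      ring

lemma summable_eichlerTerm_bound (k : ℕ) {δ : ℝ} (hδ : 0 < δ) :
    Summable fun n : ℕ ↦
      (2 * π) ^ k * (((n + 1 : ℕ) : ℝ) ^ k * Real.exp (-(2 * π * δ)) ^ (n + 1)) := by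
  refine Summable.mul_left _ ((summable_nat_add_iff (f := fun n : ℕ ↦
    (n : ℝ) ^ k * Real.exp (-(2 * π * δ)) ^ n) 1).2
    (summable_pow_mul_geometric_of_norm_lt_one k ?_))
  rw [Real.norm_eq_abs, Real.abs_exp, Real.exp_lt_one_iff]
  have := Real.pi_pos
  simp only [Left.neg_neg_iff]
  positivity

lemma hasDerivAt_eichler (k : ℕ) {z : ℂ} (hz : 0 < z.im) :
    HasDerivAt (eichler k) (eichler (k + 1) z) z := by
  have hδ : 0 < z.im / 2 := by positivity
  have hmem : z ∈ {w : ℂ | z.im / 2 < w.im} := by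
    simp only [Set.mem_ofPred_eq]
    linarith
  exact hasDerivAt_tsum_of_isPreconnected (summable_eichlerTerm_bound (k + 1) hδ)
    (isOpen_lt continuous_const Complex.continuous_im)
    (convex_halfSpace_im_gt _).isPreconnected
    (fun n w _ ↦ hasDerivAt_eichlerTerm k n w)
    (fun n w hw ↦ norm_eichlerTerm_le (k + 1) n (le_of_lt hw)) hmem
    (.of_norm_bounded (summable_eichlerTerm_bound k hδ)
      fun n ↦ norm_eichlerTerm_le k n (le_of_lt hmem)) hmem

lemma norm_eichlerTerm_zero_le (n : ℕ) {z : ℂ} (hz : 0 ≤ z.im) :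
    ‖eichlerTerm 0 n z‖ ≤ sigmaCoeff n := by
  rw [norm_eichlerTerm, pow_zero, mul_one]
  refine mul_le_of_le_one_right (sigmaCoeff_nonneg n) (pow_le_one₀ (Real.exp_nonneg _) ?_)
  rw [Real.exp_le_one_iff, neg_nonpos]
  have := Real.pi_pos
  positivity

lemma summable_eichlerTerm_zero {z : ℂ} (hz : 0 ≤ z.im) :
    Summable fun n ↦ eichlerTerm 0 n z :=
  .of_norm_bounded summable_sigmaCoeff fun n ↦ norm_eichlerTerm_zero_le n hz

lemma continuousOn_eichler_zero : ContinuousOn (eichler 0) {z : ℂ | 0 ≤ z.im} :=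
  continuousOn_tsum (fun n z _ ↦ (hasDerivAt_eichlerTerm 0 n z).continuousAt.continuousWithinAt)
    summable_sigmaCoeff fun n _ hz ↦ norm_eichlerTerm_zero_le n hz

lemma norm_eichler_zero_le {z : ℂ} (hz : 0 ≤ z.im) : ‖eichler 0 z‖ ≤ ∑' n, sigmaCoeff n :=
  tsum_of_norm_bounded summable_sigmaCoeff.hasSum fun n ↦ norm_eichlerTerm_zero_le n hz

lemma eichlerTerm_zero_ofReal (n : ℕ) (x : ℝ) :
    eichlerTerm 0 n x = ((sigmaCoeff n * Real.cos (2 * π * ((n : ℝ) + 1) * x) : ℝ) : ℂ) +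
      ((sigmaCoeff n * Real.sin (2 * π * ((n : ℝ) + 1) * x) : ℝ) : ℂ) * Complex.I := by
  rw [eichlerTerm, show (2 * π * Complex.I * ((n : ℂ) + 1) * x : ℂ)
    = ((2 * π * ((n : ℝ) + 1) * x : ℝ) : ℂ) * Complex.I by push_cast; ring, Complex.exp_mul_I]
  push_cast
  ring

lemma re_eichler_zero_ofReal (x : ℝ) : (eichler 0 x).re = G2 x := by
  rw [eichler, Complex.re_tsum (summable_eichlerTerm_zero (by simp))]
  refine tsum_congr fun n ↦ ?_
  rw [eichlerTerm_zero_ofReal, Complex.add_re, Complex.re_ofReal_mul, Complex.ofReal_re,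
    Complex.I_re, mul_zero, add_zero, sigmaCoeff]

lemma im_eichler_zero_ofReal (x : ℝ) : (eichler 0 x).im = F2 x := by
  rw [eichler, Complex.im_tsum (summable_eichlerTerm_zero (by simp))]
  refine tsum_congr fun n ↦ ?_
  rw [eichlerTerm_zero_ofReal, Complex.add_im, Complex.im_ofReal_mul, Complex.ofReal_im,
    Complex.I_im, mul_one, zero_add, sigmaCoeff]

lemma cos_sin_gauss (n : ℕ) (t : ℝ) :
    Real.cos (2 * π * ((n : ℝ) + 1) * gauss t) = Real.cos (2 * π * ((n : ℝ) + 1) * t⁻¹) ∧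
    Real.sin (2 * π * ((n : ℝ) + 1) * gauss t) = Real.sin (2 * π * ((n : ℝ) + 1) * t⁻¹) := by
  have h : gauss t = t⁻¹ - (⌊t⁻¹⌋ : ℝ) := by
    rw [gauss]
    split_ifs with ht
    · simp [ht]
    · rfl
  have h' : 2 * π * ((n : ℝ) + 1) * gauss t
      = 2 * π * ((n : ℝ) + 1) * t⁻¹ - (((n : ℤ) + 1) * ⌊t⁻¹⌋ : ℤ) * (2 * π) := by
    rw [h]
    push_cast
    ring
  rw [h']
  exact ⟨Real.cos_sub_int_mul_two_pi _ _, Real.sin_sub_int_mul_two_pi _ _⟩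

lemma G2_gauss (t : ℝ) : G2 (gauss t) = G2 (-t⁻¹) :=
  tsum_congr fun n ↦ by rw [(cos_sin_gauss n t).1, mul_neg, Real.cos_neg]

lemma F2_gauss (t : ℝ) : F2 (gauss t) = -F2 (-t⁻¹) := by
  rw [F2, F2, ← tsum_neg]
  exact tsum_congr fun n ↦ by rw [(cos_sin_gauss n t).2, mul_neg, Real.sin_neg]; ring

lemma eichler_three (z : UpperHalfPlane) :
    eichler 3 z = (2 * π * Complex.I) ^ 3 * ((1 - EisensteinSeries.E2 z) / 24) := by
  rw [EisensteinSeries.E2_eq_tsum_cexp, eichler]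
  rw [tsum_pnat_eq_tsum_succ (f := fun n : ℕ ↦ ((ArithmeticFunction.sigma 1 n : ℕ) : ℂ) *
      Complex.exp (2 * π * Complex.I * z) ^ n)]
  rw [show ∀ S : ℂ, (1 - (1 - 24 * S)) / 24 = S by intro S; ring, ← tsum_mul_left]
  refine tsum_congr fun n ↦ ?_
  have hn : (n : ℂ) + 1 ≠ 0 := Nat.cast_add_one_ne_zero n
  rw [eichlerTerm, sigmaCoeff, ← Complex.exp_nat_mul, sigma1_eq_sigma]
  push_cast
  rw [show 2 * π * Complex.I * ((n : ℂ) + 1) * z = ((n : ℂ) + 1) * (2 * π * Complex.I * z) by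
    ring]
  field_simp

lemma eichler_three_neg_inv {z : ℂ} (hz : 0 < z.im) :
    eichler 3 z - eichler 3 (-z⁻¹) / z ^ 2
      = Complex.I * π ^ 3 / 3 / z ^ 2 - 2 * π ^ 2 / z - Complex.I * π ^ 3 / 3 := by
  set w : UpperHalfPlane := ⟨z, hz⟩
  have hz0 : z ≠ 0 := by
    rintro rfl
    simp at hz
  have hw : ((ModularGroup.S • w : UpperHalfPlane) : ℂ) = -z⁻¹ := by
    rw [UpperHalfPlane.modular_S_smul]
    simp [w, inv_neg]
  have h1 := eichler_three w
  have h2 := eichler_three (ModularGroup.S • w)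
  rw [hw] at h2
  have h3 := EisensteinSeries.G2_S_transform w
  have hπ : (π : ℂ) ≠ 0 := by exact_mod_cast Real.pi_ne_zero
  have hE (v : UpperHalfPlane) :
      EisensteinSeries.G2 v = π ^ 2 / 3 * EisensteinSeries.E2 v := by
    simp only [EisensteinSeries.E2, riemannZeta_two, Pi.smul_apply, smul_eq_mul]
    field_simp
    ring
  rw [hE, hE] at h3
  change eichler 3 z = _ at h1
  change _ = (z ^ 2)⁻¹ * _ - -2 * π * Complex.I / z at h3
  have h4 : EisensteinSeries.E2 w = (z ^ 2)⁻¹ * EisensteinSeries.E2 (ModularGroup.S • w)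
      + 6 * Complex.I / (π * z) := by
    field_simp at h3 ⊢
    linear_combination h3
  rw [h1, h2, h4]
  have hI : Complex.I ^ 3 = -Complex.I := Complex.I_pow_three
  have hI4 : Complex.I ^ 4 = 1 := Complex.I_pow_four
  field_simp
  ring_nf
  simp only [hI, hI4]
  ring

lemma neg_inv_im_pos {z : ℂ} (hz : 0 < z.im) : 0 < (-z⁻¹).im := by
  have hz0 : z ≠ 0 := by
    rintro rfl
    simp at hz
  rw [Complex.neg_im, Complex.inv_im, neg_div, neg_neg]
  exact div_pos hz (Complex.normSq_pos.2 hz0)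

lemma neg_inv_im_nonneg {z : ℂ} (hz : 0 ≤ z.im) : 0 ≤ (-z⁻¹).im := by
  rw [Complex.neg_im, Complex.inv_im, neg_div, neg_neg]
  exact div_nonneg hz (Complex.normSq_nonneg z)

lemma hasDerivAt_eichler_neg_inv (k : ℕ) {z : ℂ} (hz : 0 < z.im) :
    HasDerivAt (fun w ↦ eichler k (-w⁻¹)) (eichler (k + 1) (-z⁻¹) / z ^ 2) z := by
  have hz0 : z ≠ 0 := by
    rintro rfl
    simp at hz
  refine ((hasDerivAt_eichler k (neg_inv_im_pos hz)).comp z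
    (hasDerivAt_inv hz0).fun_neg).congr_deriv ?_
  ring

/-- The logarithmic and cubic part of the functional equation of `eichler 0`. -/
def logPart (z : ℂ) : ℂ :=
  -(Complex.I * π ^ 3 / 3) * (z * Complex.log z) - π ^ 2 * (z ^ 2 * Complex.log z)
    - Complex.I * π ^ 3 / 18 * z ^ 3

/-- The derivative of `logPart`. -/
def logPartDeriv (z : ℂ) : ℂ :=
  -(Complex.I * π ^ 3 / 3) * (Complex.log z + 1) - π ^ 2 * (2 * (z * Complex.log z) + z)
    - Complex.I * π ^ 3 / 6 * z ^ 2

/-- The second derivative of `logPart`. -/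
def logPartDerivTwo (z : ℂ) : ℂ :=
  -(Complex.I * π ^ 3 / 3) * z⁻¹ - π ^ 2 * (2 * Complex.log z + 3)
    - Complex.I * π ^ 3 / 3 * z

lemma hasDerivAt_mul_log {z : ℂ} (hz : z ∈ Complex.slitPlane) :
    HasDerivAt (fun w ↦ w * Complex.log w) (Complex.log z + 1) z := by
  have hz0 := Complex.slitPlane_ne_zero hz
  refine ((hasDerivAt_id z).mul (Complex.hasDerivAt_log hz)).congr_deriv ?_
  simp [hz0]

lemma hasDerivAt_logPart {z : ℂ} (hz : z ∈ Complex.slitPlane) :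
    HasDerivAt logPart (logPartDeriv z) z := by
  have hz0 := Complex.slitPlane_ne_zero hz
  refine ((((hasDerivAt_mul_log hz).const_mul (-(Complex.I * π ^ 3 / 3))).fun_sub
    (((hasDerivAt_pow 2 z).fun_mul (Complex.hasDerivAt_log hz)).const_mul (π ^ 2 : ℂ))).fun_sub
    ((hasDerivAt_pow 3 z).const_mul (Complex.I * π ^ 3 / 18))).congr_deriv ?_
  rw [logPartDeriv]
  push_cast
  field_simp
  ring

lemma hasDerivAt_logPartDeriv {z : ℂ} (hz : z ∈ Complex.slitPlane) :
    HasDerivAt logPartDeriv (logPartDerivTwo z) z := by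
  refine (((((Complex.hasDerivAt_log hz).add_const 1).const_mul
    (-(Complex.I * π ^ 3 / 3))).fun_sub
    ((((hasDerivAt_mul_log hz).const_mul 2).fun_add (hasDerivAt_id' z)).const_mul
      (π ^ 2 : ℂ))).fun_sub
    ((hasDerivAt_pow 2 z).const_mul (Complex.I * π ^ 3 / 6))).congr_deriv ?_
  rw [logPartDerivTwo]
  push_cast
  ring

lemma hasDerivAt_logPartDerivTwo {z : ℂ} (hz : z ∈ Complex.slitPlane) :
    HasDerivAt logPartDerivTwo
      (Complex.I * π ^ 3 / 3 / z ^ 2 - 2 * π ^ 2 / z - Complex.I * π ^ 3 / 3) z := by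
  refine ((((hasDerivAt_inv (Complex.slitPlane_ne_zero hz)).const_mul
    (-(Complex.I * π ^ 3 / 3))).fun_sub
    ((((Complex.hasDerivAt_log hz).const_mul 2).add_const 3).const_mul (π ^ 2 : ℂ))).fun_sub
    ((hasDerivAt_id' z).const_mul (Complex.I * π ^ 3 / 3))).congr_deriv ?_
  ring

lemma hasDerivAt_eichler_sub_slash {z : ℂ} (hz : 0 < z.im) :
    HasDerivAt (fun w ↦ eichler 0 w - w ^ 4 * eichler 0 (-w⁻¹) - logPart w)
      (eichler 1 z - 4 * z ^ 3 * eichler 0 (-z⁻¹) - z ^ 2 * eichler 1 (-z⁻¹)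
        - logPartDeriv z) z := by
  have hs : z ∈ Complex.slitPlane := Or.inr hz.ne'
  have hz0 := Complex.slitPlane_ne_zero hs
  refine (((hasDerivAt_eichler 0 hz).fun_sub ((hasDerivAt_pow 4 z).fun_mul
    (hasDerivAt_eichler_neg_inv 0 hz))).fun_sub (hasDerivAt_logPart hs)).congr_deriv ?_
  push_cast
  field_simp
  ring

lemma hasDerivAt_eichler_first {z : ℂ} (hz : 0 < z.im) :
    HasDerivAt (fun w ↦ eichler 1 w + 2 * w ^ 3 * eichler 0 (-w⁻¹) - w ^ 2 * eichler 1 (-w⁻¹)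
        - logPartDeriv w)
      (eichler 2 z + 6 * z ^ 2 * eichler 0 (-z⁻¹) - eichler 2 (-z⁻¹) - logPartDerivTwo z) z := by
  have hs : z ∈ Complex.slitPlane := Or.inr hz.ne'
  have hz0 := Complex.slitPlane_ne_zero hs
  refine ((((hasDerivAt_eichler 1 hz).fun_add (((hasDerivAt_pow 3 z).const_mul 2).fun_mul
    (hasDerivAt_eichler_neg_inv 0 hz))).fun_sub ((hasDerivAt_pow 2 z).fun_mul
    (hasDerivAt_eichler_neg_inv 1 hz))).fun_sub (hasDerivAt_logPartDeriv hs)).congr_deriv ?_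
  push_cast
  field_simp
  ring

lemma hasDerivAt_eichler_second {z : ℂ} (hz : 0 < z.im) :
    HasDerivAt (fun w ↦ eichler 2 w - eichler 2 (-w⁻¹) - logPartDerivTwo w) 0 z := by
  refine (((hasDerivAt_eichler 2 hz).fun_sub (hasDerivAt_eichler_neg_inv 2 hz)).fun_sub
    (hasDerivAt_logPartDerivTwo (Or.inr hz.ne'))).congr_deriv ?_
  rw [← eichler_three_neg_inv hz]
  ring

lemma exists_quadratic_of_hasDerivAt {f f₁ f₂ : ℝ → ℂ} (h : ∀ x, HasDerivAt f (f₁ x) x)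
    (h₁ : ∀ x, HasDerivAt f₁ (f₂ x) x) (h₂ : ∀ x, HasDerivAt f₂ 0 x) :
    ∃ a b c : ℂ, ∀ x : ℝ, f x = a + b * x + c * x ^ 2 := by
  have hconst {g : ℝ → ℂ} (hg : ∀ x, HasDerivAt g 0 x) (x : ℝ) : g x = g 0 :=
    is_const_of_deriv_eq_zero (fun x ↦ (hg x).differentiableAt) (fun x ↦ (hg x).deriv) x 0
  have hid (x : ℝ) : HasDerivAt (fun t : ℝ ↦ (t : ℂ)) 1 x := Complex.ofRealCLM.hasDerivAt
  have e₂ := hconst h₂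
  have e₁ := hconst (g := fun x ↦ f₁ x - f₂ 0 * x) fun x ↦
    ((h₁ x).fun_sub ((hid x).const_mul (f₂ 0))).congr_deriv (by rw [e₂ x]; ring)
  have e₀ := hconst (g := fun x ↦ f x - f₁ 0 * x - f₂ 0 / 2 * (x : ℂ) ^ 2) fun x ↦
    (((h x).fun_sub ((hid x).const_mul (f₁ 0))).fun_sub
      (((hid x).fun_pow 2).const_mul (f₂ 0 / 2))).congr_deriv (by
        have := e₁ x
        simp only [Complex.ofReal_zero, mul_zero, sub_zero] at this
        push_cast
        linear_combination this)
  refine ⟨f 0, f₁ 0, f₂ 0 / 2, fun x ↦ ?_⟩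
  have := e₀ x
  simp only [Complex.ofReal_zero] at this
  linear_combination this

/-- The defect in the functional equation of `eichler 0` along the line of height `y`. -/
def periodDefect (y x : ℝ) : ℂ :=
  eichler 0 (x + y * Complex.I) -
    (x + y * Complex.I) ^ 4 * eichler 0 (-((x : ℂ) + y * Complex.I)⁻¹) -
    logPart (x + y * Complex.I) -
    6 * ∫ s in (0 : ℝ)..x, ((s : ℂ) + y * Complex.I) ^ 2 * (x - s - (s + y * Complex.I)) *
      eichler 0 (-((s : ℂ) + y * Complex.I)⁻¹)

lemma continuous_eichler_neg_inv_line {y : ℝ} (hy : 0 < y) :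
    Continuous fun s : ℝ ↦ eichler 0 (-((s : ℂ) + y * Complex.I)⁻¹) := by
  refine continuous_iff_continuousAt.2 fun s ↦ ?_
  exact ContinuousAt.comp (f := fun s : ℝ ↦ (s : ℂ) + y * Complex.I)
    (hasDerivAt_eichler_neg_inv 0 (by simpa using hy)).continuousAt (by fun_prop)

lemma periodDefect_quadratic {y : ℝ} (hy : 0 < y) :
    ∃ a b c : ℂ, ∀ x : ℝ, periodDefect y x = a + b * x + c * x ^ 2 := by
  have him (x : ℝ) : 0 < ((x : ℂ) + y * Complex.I).im := by simpa using hy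
  have hid (x : ℝ) : HasDerivAt (fun t : ℝ ↦ (t : ℂ)) 1 x := Complex.ofRealCLM.hasDerivAt
  have hψ := continuous_eichler_neg_inv_line hy
  set g : ℝ → ℂ := fun s ↦ ((s : ℂ) + y * Complex.I) ^ 2 *
    eichler 0 (-((s : ℂ) + y * Complex.I)⁻¹) with hg
  have hgc : Continuous g := by fun_prop
  have hkc : Continuous fun s : ℝ ↦ (2 * s + y * Complex.I) * g s := by fun_prop
  have hA (x : ℝ) : HasDerivAt (fun x ↦ ∫ s in (0 : ℝ)..x, g s) (g x) x :=
    hgc.integral_hasStrictDerivAt 0 x |>.hasDerivAt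
  have hD (x : ℝ) : HasDerivAt (fun x ↦ ∫ s in (0 : ℝ)..x, (2 * s + y * Complex.I) * g s)
      ((2 * x + y * Complex.I) * g x) x :=
    hkc.integral_hasStrictDerivAt 0 x |>.hasDerivAt
  have hsplit (x : ℝ) : ∫ s in (0 : ℝ)..x,
      ((s : ℂ) + y * Complex.I) ^ 2 * (x - s - (s + y * Complex.I)) *
        eichler 0 (-((s : ℂ) + y * Complex.I)⁻¹)
      = x * (∫ s in (0 : ℝ)..x, g s) - ∫ s in (0 : ℝ)..x, (2 * s + y * Complex.I) * g s := by
    rw [← intervalIntegral.integral_const_mul, ← intervalIntegral.integral_sub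
      ((hgc.const_mul _).intervalIntegrable _ _) (hkc.intervalIntegrable _ _)]
    refine intervalIntegral.integral_congr fun s _ ↦ ?_
    simp only [hg]
    ring
  refine exists_quadratic_of_hasDerivAt
    (f₁ := fun x : ℝ ↦ (fun w ↦ eichler 1 w + 2 * w ^ 3 * eichler 0 (-w⁻¹)
      - w ^ 2 * eichler 1 (-w⁻¹) - logPartDeriv w) (x + y * Complex.I)
      - 6 * ∫ s in (0 : ℝ)..x, g s)
    (f₂ := fun x : ℝ ↦ (fun w ↦ eichler 2 w - eichler 2 (-w⁻¹) - logPartDerivTwo w)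
      (x + y * Complex.I)) (fun x ↦ ?_) (fun x ↦ ?_) (fun x ↦ ?_)
  · refine ((((hasDerivAt_eichler_sub_slash (him x)).comp_add_const _ _).comp_ofReal.fun_sub
      ((((hid x).fun_mul (hA x)).fun_sub (hD x)).const_mul 6)).congr_of_eventuallyEq
      (.of_forall fun t ↦ by rw [periodDefect, hsplit])).congr_deriv ?_
    simp only [hg]
    ring
  · refine (((hasDerivAt_eichler_first (him x)).comp_add_const _ _).comp_ofReal.fun_sub
      ((hA x).const_mul 6)).congr_deriv ?_
    simp only [hg]
    ring
  · exact ((hasDerivAt_eichler_second (him x)).comp_add_const _ _).comp_ofReal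

open Filter Topology in
lemma tendsto_eichler_neg_inv_line {s : ℝ} (hs : 0 < s) :
    Tendsto (fun y : ℝ ↦ eichler 0 (-((s : ℂ) + y * Complex.I)⁻¹)) (𝓝[>] 0)
      (𝓝 (eichler 0 (-((s : ℂ) + (0 : ℝ) * Complex.I)⁻¹))) := by
  have hs0 : (s : ℂ) + (0 : ℝ) * Complex.I ≠ 0 := by simpa using hs.ne'
  refine (continuousOn_eichler_zero _ (neg_inv_im_nonneg (by simp))).tendsto.comp
    (tendsto_nhdsWithin_iff.2 ⟨?_, ?_⟩)
  · have : ContinuousAt (fun y : ℝ ↦ -((s : ℂ) + y * Complex.I)⁻¹) 0 := by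
      fun_prop (disch := exact hs0)
    exact this.tendsto.mono_left nhdsWithin_le_nhds
  · filter_upwards [self_mem_nhdsWithin] with y hy
    exact neg_inv_im_nonneg (by simpa using le_of_lt hy)

open Filter Topology in
lemma tendsto_periodDefect {x : ℝ} (hx : x ∈ Set.Ioo (0 : ℝ) 1) :
    Tendsto (fun y ↦ periodDefect y x) (𝓝[>] 0) (𝓝 (periodDefect 0 x)) := by
  have hline : ContinuousAt (fun y : ℝ ↦ (x : ℂ) + y * Complex.I) 0 := by fun_prop
  have hslit : (x : ℂ) + (0 : ℝ) * Complex.I ∈ Complex.slitPlane := Or.inl (by simpa using hx.1)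
  refine Tendsto.sub (Tendsto.sub (Tendsto.sub ?_ (Tendsto.mul ?_ ?_)) ?_)
    (Tendsto.const_mul 6 ?_)
  · refine (continuousOn_eichler_zero _ (by simp)).tendsto.comp
      (tendsto_nhdsWithin_iff.2 ⟨hline.tendsto.mono_left nhdsWithin_le_nhds, ?_⟩)
    filter_upwards [self_mem_nhdsWithin] with y hy
    simpa using le_of_lt hy
  · exact (hline.pow 4).tendsto.mono_left nhdsWithin_le_nhds
  · exact tendsto_eichler_neg_inv_line hx.1
  · exact (ContinuousAt.comp (f := fun y : ℝ ↦ (x : ℂ) + y * Complex.I)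
      (hasDerivAt_logPart hslit).continuousAt hline).tendsto.mono_left nhdsWithin_le_nhds
  · have hM : 0 ≤ ∑' n, sigmaCoeff n := tsum_nonneg sigmaCoeff_nonneg
    refine intervalIntegral.tendsto_integral_filter_of_dominated_convergence
      (fun _ ↦ 2 ^ 2 * 3 * ∑' n, sigmaCoeff n) ?_ ?_ intervalIntegrable_const ?_
    · filter_upwards [self_mem_nhdsWithin] with y hy
      have := continuous_eichler_neg_inv_line hy
      exact Continuous.aestronglyMeasurable (by fun_prop)
    · filter_upwards [self_mem_nhdsWithin,
        mem_nhdsWithin_of_mem_nhds (Iio_mem_nhds (zero_lt_one' ℝ))] with y hy hy1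
      refine Filter.Eventually.of_forall fun s hs ↦ ?_
      rw [Set.uIoc_of_le hx.1.le] at hs
      have hy0 : 0 < y := hy
      have hy1 : y < 1 := hy1
      have h1 : ‖(s : ℂ) + y * Complex.I‖ ≤ 2 := by
        refine (norm_add_le _ _).trans ?_
        simp only [norm_mul, Complex.norm_real, Complex.norm_I, Real.norm_eq_abs,
          abs_of_pos hs.1, abs_of_pos hy0]
        linarith [hs.2, hx.2]
      have h2 : ‖(x : ℂ) - s - (s + y * Complex.I)‖ ≤ 3 := by
        refine (norm_sub_le _ _).trans ?_
        have : ‖(x : ℂ) - s‖ ≤ 1 := by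
          rw [← Complex.ofReal_sub, Complex.norm_real, Real.norm_eq_abs,
            abs_of_nonneg (sub_nonneg.2 hs.2)]
          linarith [hs.1, hx.2]
        linarith
      rw [norm_mul, norm_mul, norm_pow]
      gcongr
      exact norm_eichler_zero_le (neg_inv_im_nonneg (by simpa using hy0.le))
    · refine Filter.Eventually.of_forall fun s hs ↦ ?_
      rw [Set.uIoc_of_le hx.1.le] at hs
      refine Tendsto.mul ?_ (tendsto_eichler_neg_inv_line hs.1)
      have : ContinuousAt (fun y : ℝ ↦ ((s : ℂ) + y * Complex.I) ^ 2 *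
        (x - s - (s + y * Complex.I))) 0 := by fun_prop
      exact this.tendsto.mono_left nhdsWithin_le_nhds

open Filter Topology in
lemma periodDefect_zero_quadratic :
    ∃ a b c : ℂ, ∀ x ∈ Set.Ioo (0 : ℝ) 1, periodDefect 0 x = a + b * x + c * x ^ 2 := by
  set D := periodDefect with hD
  have h1 := tendsto_periodDefect (x := 1 / 4) (by norm_num)
  have h2 := tendsto_periodDefect (x := 1 / 2) (by norm_num)
  have h3 := tendsto_periodDefect (x := 3 / 4) (by norm_num)
  rw [← hD] at h1 h2 h3
  refine ⟨3 * D 0 (1 / 4) - 3 * D 0 (1 / 2) + D 0 (3 / 4),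
    -10 * D 0 (1 / 4) + 16 * D 0 (1 / 2) - 6 * D 0 (3 / 4),
    8 * D 0 (1 / 4) - 16 * D 0 (1 / 2) + 8 * D 0 (3 / 4), fun x hx ↦ ?_⟩
  refine tendsto_nhds_unique (tendsto_periodDefect hx) (Tendsto.congr' ?_
    (((((h1.const_mul 3).sub (h2.const_mul 3)).add h3).add
      ((((h1.const_mul (-10)).add (h2.const_mul 16)).sub (h3.const_mul 6)).mul_const (x : ℂ))).add
      ((((h1.const_mul 8).sub (h2.const_mul 16)).add (h3.const_mul 8)).mul_const ((x : ℂ) ^ 2))))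
  filter_upwards [self_mem_nhdsWithin] with y hy
  obtain ⟨a, b, c, habc⟩ := periodDefect_quadratic hy
  rw [← hD] at habc ⊢
  simp only [habc]
  push_cast
  ring

lemma intervalIntegrable_mul_eichler_neg_inv {k : ℝ → ℂ} (hk : Continuous k) {x : ℝ}
    (hx : 0 ≤ x) :
    IntervalIntegrable (fun s : ℝ ↦ k s * eichler 0 (-((s : ℂ))⁻¹)) MeasureTheory.volume 0 x := by
  refine IntervalIntegrable.continuousOn_mul ?_ hk.continuousOn
  rw [intervalIntegrable_iff_integrableOn_Ioc_of_le hx]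
  refine MeasureTheory.Integrable.of_bound
    (ContinuousOn.aestronglyMeasurable ?_ measurableSet_Ioc) (∑' n, sigmaCoeff n)
    (Filter.Eventually.of_forall fun s ↦ norm_eichler_zero_le (neg_inv_im_nonneg (by simp)))
  refine continuousOn_eichler_zero.comp (fun s hs ↦ ?_) fun s _ ↦ neg_inv_im_nonneg (by simp)
  have : (s : ℂ) ≠ 0 := by exact_mod_cast hs.1.ne'
  exact ContinuousAt.continuousWithinAt (by fun_prop (disch := exact this))

lemma eichler_zero_neg_inv_ofReal (t : ℝ) :
    eichler 0 (-(t : ℂ)⁻¹) = (G2 (gauss t) : ℂ) - F2 (gauss t) * Complex.I := by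
  have h : -(t : ℂ)⁻¹ = ((-t⁻¹ : ℝ) : ℂ) := by push_cast; rfl
  rw [h, G2_gauss, F2_gauss, ← Complex.re_add_im (eichler 0 _), re_eichler_zero_ofReal,
    im_eichler_zero_ofReal]
  push_cast
  ring

lemma integral_eichler_neg_inv {x : ℝ} (hx : 0 ≤ x) :
    ∫ s in (0 : ℝ)..x, ((s : ℂ) ^ 2 * (x - 2 * s)) * eichler 0 (-(s : ℂ)⁻¹)
      = (∫ t in (0 : ℝ)..x, t ^ 2 * (x - 2 * t) * G2 (gauss t) : ℝ)
        - (∫ t in (0 : ℝ)..x, t ^ 2 * (x - 2 * t) * F2 (gauss t) : ℝ) * Complex.I := by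
  have hint := intervalIntegrable_mul_eichler_neg_inv
    (k := fun s ↦ (s : ℂ) ^ 2 * (x - 2 * s)) (by fun_prop) hx
  have hre := Complex.reCLM.intervalIntegral_comp_comm hint
  have him := Complex.imCLM.intervalIntegral_comp_comm hint
  have hval (s : ℝ) : ((s : ℂ) ^ 2 * (x - 2 * s)) * eichler 0 (-(s : ℂ)⁻¹)
      = ((s ^ 2 * (x - 2 * s) * G2 (gauss s) : ℝ) : ℂ)
        + ((-(s ^ 2 * (x - 2 * s) * F2 (gauss s)) : ℝ) : ℂ) * Complex.I := by
    rw [eichler_zero_neg_inv_ofReal]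
    push_cast
    ring
  rw [← Complex.re_add_im (∫ s in (0 : ℝ)..x, _)]
  simp only [Complex.reCLM_apply, Complex.imCLM_apply] at hre him
  rw [← hre, ← him]
  simp only [hval, Complex.add_re, Complex.add_im, Complex.re_ofReal_mul, Complex.im_ofReal_mul,
    Complex.ofReal_re, Complex.ofReal_im, Complex.I_re, Complex.I_im, mul_zero, add_zero, zero_add,
    mul_one]
  rw [intervalIntegral.integral_neg]
  push_cast
  ring

lemma logPart_ofReal {x : ℝ} (hx : 0 ≤ x) :
    logPart x = ((-(π ^ 2 * x ^ 2 * Real.log x) : ℝ) : ℂ)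
      + ((-(π ^ 3 / 3 * x * Real.log x) - π ^ 3 / 18 * x ^ 3 : ℝ) : ℂ) * Complex.I := by
  rw [logPart, ← Complex.ofReal_log hx]
  push_cast
  ring

/-- Functional equations for `F₂` and `G₂` on `(0,1)` in terms of the Gauss map `T`:
`F₂(x) = −x⁴F₂(T x) − (π³/3)x log x + P(x) − 6∫₀ˣ t²(x−2t)F₂(T t) dt` and
`G₂(x) = x⁴G₂(T x) − π²x² log x + Q(x) + 6∫₀ˣ t²(x−2t)G₂(T t) dt`
for some real polynomials `P, Q` of degree at most 3. -/
theorem F2_G2_functional_equations :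
    ∃ P Q : Polynomial ℝ, P.degree ≤ 3 ∧ Q.degree ≤ 3 ∧
      ∀ x ∈ Set.Ioo (0 : ℝ) 1,
        (F2 x = -x ^ 4 * F2 (gauss x) - (π ^ 3 / 3) * x * Real.log x + P.eval x
            - 6 * ∫ t in (0 : ℝ)..x, t ^ 2 * (x - 2 * t) * F2 (gauss t)) ∧
        (G2 x = x ^ 4 * G2 (gauss x) - π ^ 2 * x ^ 2 * Real.log x + Q.eval x
            + 6 * ∫ t in (0 : ℝ)..x, t ^ 2 * (x - 2 * t) * G2 (gauss t)) := by
  open Polynomial in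
  obtain ⟨a, b, c, habc⟩ := periodDefect_zero_quadratic
  refine ⟨C (-(π ^ 3 / 18)) * X ^ 3 + C c.im * X ^ 2 + C b.im * X + C a.im,
    C 0 * X ^ 3 + C c.re * X ^ 2 + C b.re * X + C a.re,
    degree_cubic_le, degree_cubic_le, fun x hx ↦ ?_⟩
  have h := habc x hx
  rw [periodDefect] at h
  simp only [Complex.ofReal_zero, zero_mul, add_zero] at h
  have hI : ∫ s in (0 : ℝ)..x, (s : ℂ) ^ 2 * (x - s - s) * eichler 0 (-(s : ℂ)⁻¹)
      = ∫ s in (0 : ℝ)..x, ((s : ℂ) ^ 2 * (x - 2 * s)) * eichler 0 (-(s : ℂ)⁻¹) :=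
    intervalIntegral.integral_congr fun s _ ↦ by ring
  rw [hI, integral_eichler_neg_inv hx.1.le, logPart_ofReal hx.1.le, eichler_zero_neg_inv_ofReal,
    ← Complex.re_add_im (eichler 0 x), re_eichler_zero_ofReal, im_eichler_zero_ofReal,
    ← Complex.re_add_im a, ← Complex.re_add_im b, ← Complex.re_add_im c,
    ← Complex.ofReal_pow, ← Complex.ofReal_pow] at h
  have hre := congrArg Complex.re h
  have him := congrArg Complex.im h
  simp only [Complex.add_re, Complex.sub_re, Complex.mul_re, Complex.add_im, Complex.sub_im,
    Complex.mul_im, Complex.ofReal_re, Complex.ofReal_im, Complex.I_re, Complex.I_im,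
    Complex.re_ofNat, Complex.im_ofNat] at hre him
  simp only [eval_add, eval_mul, eval_C, eval_pow, eval_X]
  constructor
  · linear_combination him
  · linear_combination hre


end
end

section
/- Let P ∈ ℝ[X] be a polynomial of degree at most 3 such that F_2(x) = −x^4·F_2(T(x)) − (π^3/3)·x·log(x) + P(x) − 6·∫_0^x t^2·(x−2t)·F_2(T(t)) dt holds for all x ∈ (0,1). Then for every irrational x ∈ (0,1): F_2(x) = (π^3/3)·∑_{k=0}^∞ (−1)^k·β_{k−1}(x)^2·β_k(x)·γ_k(x) + ∑_{k=0}^∞ (−1)^k·P(T^k(x))·β_{k−1}(x)^4 + 6·∑_{k=0}^∞ (−1)^{k+1}·β_{k−1}(x)^4·∫_0^{T^k(x)} t^2·(T^k(x)−2t)·F_2(T(t)) dt, and all three series converge absolutely. -/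
open Real

noncomputable section

/-- `betaCF x k = β_{k−1}(x) = ∏_{j=0}^{k−1} T^j(x)`; in particular `betaCF x 0 = β_{−1} = 1`. -/
def betaCF (x : ℝ) (k : ℕ) : ℝ := ∏ j ∈ Finset.range k, gauss^[j] x

/-- `γ_k(x) = β_{k−1}(x) · log(1/T^k(x))`. -/
def gammaCF (x : ℝ) (k : ℕ) : ℝ := betaCF x k * Real.log (gauss^[k] x)⁻¹

theorem sigma1_le_mul_sqrt (n : ℕ) : (sigma1 n : ℝ) ≤ 2 * n * √n := by
  rcases Nat.eq_zero_or_pos n with rfl | hn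
  · simp [sigma1]
  have hn' : (0 : ℝ) < n := Nat.cast_pos.2 hn
  have hharm : (sigma1 n : ℝ) ≤ n * (harmonic n : ℝ) := by
    rw [sigma1, ← Nat.sum_div_divisors, harmonic_eq_sum_Icc, Nat.cast_sum, Rat.cast_sum,
      Finset.mul_sum]
    calc ∑ d ∈ n.divisors, ((n / d : ℕ) : ℝ)
        ≤ ∑ d ∈ n.divisors, (n : ℝ) * (((d : ℚ)⁻¹ : ℚ) : ℝ) :=
          Finset.sum_le_sum fun d _ => by
            rw [Rat.cast_inv, Rat.cast_natCast, ← div_eq_mul_inv]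
            exact Nat.cast_div_le
      _ ≤ _ := Finset.sum_le_sum_of_subset_of_nonneg
          (fun d hd => Finset.mem_Icc.2 ⟨Nat.pos_of_mem_divisors hd, Nat.divisor_le hd⟩)
          fun d _ _ => by positivity
  have hlog : log n ≤ 2 * (√n - 1) := by
    have := Real.log_le_sub_one_of_pos (Real.sqrt_pos.2 hn')
    rw [Real.log_sqrt hn'.le] at this
    linarith
  calc (sigma1 n : ℝ) ≤ n * (harmonic n : ℝ) := hharm
    _ ≤ n * (2 * √n) := by
      have := harmonic_le_one_add_log n
      gcongr
      linarith
    _ = 2 * n * √n := by ring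

theorem summable_sigma1_div_cube :
    Summable fun n : ℕ => (sigma1 (n + 1) : ℝ) / ((n : ℝ) + 1) ^ 3 := by
  have h : Summable fun n : ℕ => 2 * (1 / ((n + 1 : ℕ) : ℝ) ^ (3 / 2 : ℝ)) :=
    ((summable_nat_add_iff 1).2
      (Real.summable_one_div_nat_rpow.2 (by norm_num : (1 : ℝ) < 3 / 2))).mul_left 2
  refine h.of_nonneg_of_le (fun n => by positivity) fun n => ?_
  have hσ := sigma1_le_mul_sqrt (n + 1)
  push_cast at hσ ⊢
  have hpos : (0 : ℝ) < n + 1 := by positivity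
  rw [div_le_iff₀ (by positivity)]
  refine hσ.trans (le_of_eq ?_)
  have h3 : ((n : ℝ) + 1) ^ 3 =
      ((n : ℝ) + 1) ^ (3 / 2 : ℝ) * (((n : ℝ) + 1) * √((n : ℝ) + 1)) := by
    rw [Real.sqrt_eq_rpow, ← Real.rpow_one_add' hpos.le (by norm_num), ← Real.rpow_add hpos,
      ← Real.rpow_natCast]
    norm_num
  rw [h3]
  field_simp

theorem exists_abs_F2_le : ∃ C, ∀ x, |F2 x| ≤ C := by
  refine ⟨∑' n : ℕ, (sigma1 (n + 1) : ℝ) / ((n : ℝ) + 1) ^ 3, fun x => ?_⟩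
  rw [← Real.norm_eq_abs]
  refine tsum_of_norm_bounded summable_sigma1_div_cube.hasSum fun n => ?_
  rw [norm_mul, Real.norm_of_nonneg (by positivity)]
  exact mul_le_of_le_one_right (by positivity) (Real.abs_sin_le_one _)

theorem irrational_gauss {x : ℝ} (hx : Irrational x) : Irrational (gauss x) := by
  rw [gauss, if_neg hx.ne_zero, Int.fract]
  exact (irrational_inv_iff.2 hx).sub_intCast _

theorem gauss_mem_Ioo {x : ℝ} (hx : Irrational x) : gauss x ∈ Set.Ioo (0 : ℝ) 1 := by
  refine ⟨lt_of_le_of_ne ?_ (irrational_gauss hx).ne_zero.symm, ?_⟩ <;>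
    rw [gauss, if_neg hx.ne_zero]
  · exact Int.fract_nonneg _
  · exact Int.fract_lt_one _

theorem irrational_gauss_iterate {x : ℝ} (hx : Irrational x) (k : ℕ) :
    Irrational (gauss^[k] x) := by
  induction k with
  | zero => exact hx
  | succ k ih => rw [Function.iterate_succ_apply']; exact irrational_gauss ih

theorem gauss_iterate_mem_Ioo {x : ℝ} (hx : Irrational x) (h01 : x ∈ Set.Ioo (0 : ℝ) 1) (k : ℕ) :
    gauss^[k] x ∈ Set.Ioo (0 : ℝ) 1 := by
  cases k with
  | zero => exact h01
  | succ k =>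
    rw [Function.iterate_succ_apply']
    exact gauss_mem_Ioo (irrational_gauss_iterate hx k)

theorem mul_gauss_le_half {y : ℝ} (hy : y ∈ Set.Ioo (0 : ℝ) 1) : y * gauss y ≤ 1 / 2 := by
  rw [gauss, if_neg hy.1.ne', Int.fract, mul_sub, mul_inv_cancel₀ hy.1.ne']
  have hfl : (1 : ℝ) ≤ ⌊y⁻¹⌋ := by
    exact_mod_cast Int.le_floor.2 (by simpa using (one_lt_inv₀ hy.1).2 hy.2 |>.le)
  have hlt := mul_lt_mul_of_pos_left (Int.lt_floor_add_one y⁻¹) hy.1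
  rw [mul_inv_cancel₀ hy.1.ne'] at hlt
  nlinarith [hy.1]

theorem betaCF_succ (x : ℝ) (k : ℕ) : betaCF x (k + 1) = betaCF x k * gauss^[k] x :=
  Finset.prod_range_succ _ _

theorem betaCF_pos {x : ℝ} (hx : Irrational x) (h01 : x ∈ Set.Ioo (0 : ℝ) 1) (k : ℕ) :
    0 < betaCF x k :=
  Finset.prod_pos fun j _ => (gauss_iterate_mem_Ioo hx h01 j).1

theorem betaCF_le_one {x : ℝ} (hx : Irrational x) (h01 : x ∈ Set.Ioo (0 : ℝ) 1) (k : ℕ) :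
    betaCF x k ≤ 1 :=
  Finset.prod_le_one (fun j _ => (gauss_iterate_mem_Ioo hx h01 j).1.le)
    fun j _ => (gauss_iterate_mem_Ioo hx h01 j).2.le

theorem betaCF_le_geometric {x : ℝ} (hx : Irrational x) (h01 : x ∈ Set.Ioo (0 : ℝ) 1) :
    ∀ k : ℕ, betaCF x k ≤ 2 * (3 / 4) ^ k
  | 0 => by norm_num [betaCF]
  | 1 => (betaCF_le_one hx h01 1).trans (by norm_num)
  | k + 2 => by
    have ih := betaCF_le_geometric hx h01 k
    have hhalf := mul_gauss_le_half (gauss_iterate_mem_Ioo hx h01 k)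
    rw [betaCF_succ, betaCF_succ, Function.iterate_succ_apply', mul_assoc]
    have := mul_le_mul_of_nonneg_left hhalf (betaCF_pos hx h01 k).le
    have hp : (0 : ℝ) < (3 / 4) ^ k := by positivity
    rw [pow_add]
    linarith

theorem summable_betaCF_pow_four {x : ℝ} (hx : Irrational x) (h01 : x ∈ Set.Ioo (0 : ℝ) 1) :
    Summable fun k => betaCF x k ^ 4 := by
  have hg : Summable fun k : ℕ => 2 * (3 / 4 : ℝ) ^ k :=
    (summable_geometric_of_lt_one (by norm_num) (by norm_num)).mul_left 2
  refine hg.of_nonneg_of_le (fun k => by positivity) fun k => ?_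
  exact (pow_le_of_le_one (betaCF_pos hx h01 k).le (betaCF_le_one hx h01 k) (by norm_num)).trans
    (betaCF_le_geometric hx h01 k)

theorem summable_abs_of_le_betaCF {x : ℝ} (hx : Irrational x) (h01 : x ∈ Set.Ioo (0 : ℝ) 1)
    {f : ℕ → ℝ} {C : ℝ} (hf : ∀ k, |f k| ≤ C * betaCF x k ^ 4) :
    Summable fun k => |f k| :=
  ((summable_betaCF_pow_four hx h01).mul_left C).of_nonneg_of_le (fun _ => abs_nonneg _) hf

theorem abs_mul_log_inv_le_one {y : ℝ} (hy : y ∈ Set.Ioo (0 : ℝ) 1) : |y * log y⁻¹| ≤ 1 := by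
  have hlog : 0 ≤ log y⁻¹ := Real.log_nonneg ((one_lt_inv₀ hy.1).2 hy.2).le
  rw [abs_of_nonneg (mul_nonneg hy.1.le hlog)]
  have := mul_le_mul_of_nonneg_left (Real.log_le_sub_one_of_pos (inv_pos.2 hy.1)) hy.1.le
  rw [mul_sub, mul_inv_cancel₀ hy.1.ne'] at this
  linarith [hy.1]

theorem abs_integral_sq_mul_sub_le {f : ℝ → ℝ} {C : ℝ} (hf : ∀ t, |f t| ≤ C) {y : ℝ}
    (hy : y ∈ Set.Ioo (0 : ℝ) 1) : |∫ t in (0 : ℝ)..y, t ^ 2 * (y - 2 * t) * f t| ≤ C := by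
  have hC : 0 ≤ C := (abs_nonneg _).trans (hf 0)
  have h := intervalIntegral.norm_integral_le_of_norm_le_const (a := 0) (b := y) (C := C)
    (f := fun t => t ^ 2 * (y - 2 * t) * f t) fun t ht => by
      rw [Set.uIoc_of_le hy.1.le] at ht
      rw [Real.norm_eq_abs, abs_mul, abs_mul]
      have h1 : |t ^ 2| ≤ 1 := by
        rw [abs_of_nonneg (sq_nonneg t)]
        exact pow_le_one₀ ht.1.le (ht.2.trans hy.2.le)
      have h2 : |y - 2 * t| ≤ 1 := abs_le.2 ⟨by linarith [ht.2, hy.2], by linarith [ht.1, hy.2]⟩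
      exact (mul_le_mul (mul_le_one₀ h1 (abs_nonneg _) h2) (hf t) (abs_nonneg _)
        zero_le_one).trans_eq (one_mul C)
  rw [Real.norm_eq_abs, sub_zero, abs_of_pos hy.1] at h
  exact h.trans (mul_le_of_le_one_right hC hy.2.le)

theorem exists_abs_eval_le (P : Polynomial ℝ) :
    ∃ C, ∀ y ∈ Set.Ioo (0 : ℝ) 1, |P.eval y| ≤ C := by
  obtain ⟨C, hC⟩ := (isCompact_Icc (a := (0 : ℝ)) (b := 1)).exists_bound_of_continuousOn
    P.continuous.continuousOn
  exact ⟨C, fun y hy => hC y (Set.Ioo_subset_Icc_self hy)⟩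

/-- Telescoping of a recursion `F (T^k x) = g k - (T^k x)^4 * F (T^(k+1) x)`. -/
theorem eq_sum_add_remainder {F : ℝ → ℝ} {g : ℕ → ℝ} {x : ℝ}
    (h : ∀ k, F (gauss^[k] x) = g k - (gauss^[k] x) ^ 4 * F (gauss^[k + 1] x)) (n : ℕ) :
    F x = ∑ k ∈ Finset.range n, (-1) ^ k * betaCF x k ^ 4 * g k
      + (-1) ^ n * betaCF x n ^ 4 * F (gauss^[n] x) := by
  induction n with
  | zero => simp [betaCF]
  | succ n ih =>
    rw [ih, h n, Finset.sum_range_succ, betaCF_succ]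
    ring

/-- Iterating the functional equation of `F₂`: if `P` is a polynomial of degree ≤ 3 with
`F₂(x) = −x⁴F₂(T x) − (π³/3)x log x + P(x) − 6∫₀ˣ t²(x−2t)F₂(T t) dt` on `(0,1)`, then for
every irrational `x ∈ (0,1)` the three series below converge absolutely and
`F₂(x) = (π³/3)∑(−1)^k β_{k−1}²β_k γ_k + ∑(−1)^k P(T^k x) β_{k−1}⁴
  + 6∑(−1)^{k+1} β_{k−1}⁴ ∫₀^{T^k x} t²(T^k x − 2t) F₂(T t) dt`. -/
theorem F2_iterated_functional_equation (P : Polynomial ℝ) (hdeg : P.degree ≤ 3)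
    (hfe : ∀ x ∈ Set.Ioo (0 : ℝ) 1,
      F2 x = -x ^ 4 * F2 (gauss x) - (π ^ 3 / 3) * x * Real.log x + P.eval x
        - 6 * ∫ t in (0 : ℝ)..x, t ^ 2 * (x - 2 * t) * F2 (gauss t)) :
    ∀ x ∈ Set.Ioo (0 : ℝ) 1, Irrational x →
      (Summable fun k : ℕ =>
        |(-1 : ℝ) ^ k * betaCF x k ^ 2 * betaCF x (k + 1) * gammaCF x k|) ∧
      (Summable fun k : ℕ =>
        |(-1 : ℝ) ^ k * P.eval (gauss^[k] x) * betaCF x k ^ 4|) ∧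
      (Summable fun k : ℕ =>
        |(-1 : ℝ) ^ (k + 1) * betaCF x k ^ 4 *
          ∫ t in (0 : ℝ)..(gauss^[k] x), t ^ 2 * (gauss^[k] x - 2 * t) * F2 (gauss t)|) ∧
      F2 x =
        (π ^ 3 / 3) *
            ∑' k : ℕ, (-1 : ℝ) ^ k * betaCF x k ^ 2 * betaCF x (k + 1) * gammaCF x k
          + ∑' k : ℕ, (-1 : ℝ) ^ k * P.eval (gauss^[k] x) * betaCF x k ^ 4
          + 6 * ∑' k : ℕ, (-1 : ℝ) ^ (k + 1) * betaCF x k ^ 4 *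
              ∫ t in (0 : ℝ)..(gauss^[k] x), t ^ 2 * (gauss^[k] x - 2 * t) * F2 (gauss t) := by
  intro x h01 hx
  have hmem := gauss_iterate_mem_Ioo hx h01
  obtain ⟨C, hC⟩ := exists_abs_F2_le
  obtain ⟨D, hD⟩ := exists_abs_eval_le P
  have hb : ∀ k, 0 ≤ betaCF x k ^ 4 := fun k => by positivity
  have hlog : Summable fun k : ℕ =>
      |(-1 : ℝ) ^ k * betaCF x k ^ 2 * betaCF x (k + 1) * gammaCF x k| := by
    refine summable_abs_of_le_betaCF hx h01 (C := 1) fun k => ?_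
    have he : (-1 : ℝ) ^ k * betaCF x k ^ 2 * betaCF x (k + 1) * gammaCF x k =
        (-1) ^ k * (gauss^[k] x * log (gauss^[k] x)⁻¹) * betaCF x k ^ 4 := by
      rw [gammaCF, betaCF_succ]
      ring
    rw [he, abs_mul, abs_of_nonneg (hb k), abs_mul, abs_neg_one_pow, one_mul]
    exact mul_le_mul_of_nonneg_right (abs_mul_log_inv_le_one (hmem k)) (hb k)
  have hpoly : Summable fun k : ℕ =>
      |(-1 : ℝ) ^ k * P.eval (gauss^[k] x) * betaCF x k ^ 4| := by
    refine summable_abs_of_le_betaCF hx h01 (C := D) fun k => ?_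
    rw [abs_mul, abs_of_nonneg (hb k), abs_mul, abs_neg_one_pow, one_mul]
    exact mul_le_mul_of_nonneg_right (hD _ (hmem k)) (hb k)
  have hint : Summable fun k : ℕ => |(-1 : ℝ) ^ (k + 1) * betaCF x k ^ 4 *
      ∫ t in (0 : ℝ)..(gauss^[k] x), t ^ 2 * (gauss^[k] x - 2 * t) * F2 (gauss t)| := by
    refine summable_abs_of_le_betaCF hx h01 (C := C) fun k => ?_
    rw [abs_mul, abs_mul, abs_neg_one_pow, one_mul, abs_of_nonneg (hb k), mul_comm]
    exact mul_le_mul_of_nonneg_right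
      (abs_integral_sq_mul_sub_le (fun t => hC (gauss t)) (hmem k)) (hb k)
  refine ⟨hlog, hpoly, hint, ?_⟩
  have hsum := ((hlog.of_abs.hasSum.mul_left (π ^ 3 / 3)).add hpoly.of_abs.hasSum).add
    (hint.of_abs.hasSum.mul_left 6)
  have hrem : Filter.Tendsto (fun n => (-1) ^ n * betaCF x n ^ 4 * F2 (gauss^[n] x))
      Filter.atTop (nhds 0) := by
    refine squeeze_zero_norm (fun n => ?_)
      (by simpa using (summable_betaCF_pow_four hx h01).tendsto_atTop_zero.mul_const C)
    rw [Real.norm_eq_abs, abs_mul, abs_mul, abs_neg_one_pow, one_mul, abs_of_nonneg (hb n)]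
    exact mul_le_mul_of_nonneg_left (hC _) (hb n)
  have hlim := hsum.tendsto_sum_nat.add hrem
  rw [add_zero] at hlim
  refine tendsto_nhds_unique (tendsto_const_nhds.congr fun n => ?_) hlim
  rw [eq_sum_add_remainder (F := F2) (g := fun k =>
    π ^ 3 / 3 * (gauss^[k] x * log (gauss^[k] x)⁻¹) + P.eval (gauss^[k] x)
      - 6 * ∫ t in (0 : ℝ)..(gauss^[k] x), t ^ 2 * (gauss^[k] x - 2 * t) * F2 (gauss t))
    (fun k => ?_) n]
  · congr 1
    refine Finset.sum_congr rfl fun k _ => ?_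
    rw [gammaCF, betaCF_succ]
    ring
  · rw [hfe _ (hmem k), ← Function.iterate_succ_apply' gauss k x, Real.log_inv]
    ring

end
end

section
/- For every irrational x ∈ (0,1) and every integer k ≥ 0: (−1)^k·β_k(x)·∑_{j=0}^{k} (−1)^j·T^j(x)/β_j(x)^2 = q_k(x). -/
open Real

noncomputable section

/-- The denominators `q_n(x)` of the continued fraction convergents of `x`:
`q_0 = 1`, `q_1 = a_1 = ⌊1/x⌋`, and `q_{n+2} = a_{n+2} q_{n+1} + q_n`
where `a_i(x) = ⌊1/T^{i-1}(x)⌋`. -/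
def qden (x : ℝ) : ℕ → ℤ
  | 0 => 1
  | 1 => ⌊x⁻¹⌋
  | n + 2 => ⌊(gauss^[n + 1] x)⁻¹⌋ * qden x (n + 1) + qden x n

theorem irrational_gauss_s16 {y : ℝ} (hy : Irrational y) : Irrational (gauss y) := by
  rw [gauss, if_neg hy.ne_zero, Int.fract]
  exact hy.inv.sub_intCast _

theorem irrational_iterate_gauss {x : ℝ} (hx : Irrational x) (n : ℕ) :
    Irrational (gauss^[n] x) := by
  induction n with
  | zero => exact hx
  | succ n ih =>
    rw [Function.iterate_succ_apply']
    exact irrational_gauss_s16 ih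

theorem floor_inv_add_gauss {y : ℝ} (hy : y ≠ 0) : (⌊y⁻¹⌋ : ℝ) + gauss y = y⁻¹ := by
  rw [gauss, if_neg hy, Int.floor_add_fract]

theorem betaCF_ne_zero {x : ℝ} (hx : Irrational x) (k : ℕ) : betaCF x k ≠ 0 :=
  Finset.prod_ne_zero_iff.mpr fun j _ => (irrational_iterate_gauss hx j).ne_zero

theorem qden_succ_add_gauss_mul_qden {x : ℝ} (hx : Irrational x) (k : ℕ) :
    (qden x (k + 1) : ℝ) + gauss^[k + 1] x * qden x k = (betaCF x (k + 1))⁻¹ := by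
  induction k with
  | zero => simpa [qden, betaCF] using floor_inv_add_gauss hx.ne_zero
  | succ k ih =>
    have ht := (irrational_iterate_gauss hx (k + 1)).ne_zero
    have hfloor := floor_inv_add_gauss ht
    rw [← Function.iterate_succ_apply' gauss] at hfloor
    rw [betaCF_succ x (k + 1), mul_inv, ← ih, qden]
    push_cast
    rw [eq_sub_of_add_eq hfloor]
    field_simp
    ring

/-- `(−1)^k β_k(x) ∑_{j=0}^k (−1)^j T^j(x)/β_j(x)² = q_k(x)` for irrational `x ∈ (0,1)`. -/
theorem qden_eq_alternating_sum (x : ℝ) (hx : x ∈ Set.Ioo (0 : ℝ) 1) (hirr : Irrational x)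
    (k : ℕ) :
    (-1 : ℝ) ^ k * betaCF x (k + 1) *
        ∑ j ∈ Finset.range (k + 1), (-1 : ℝ) ^ j * gauss^[j] x / betaCF x (j + 1) ^ 2 =
      (qden x k : ℝ) := by
  induction k with
  | zero =>
    have := hirr.ne_zero
    simp [qden, betaCF]
    field_simp
  | succ k ih =>
    have ht := (irrational_iterate_gauss hirr (k + 1)).ne_zero
    have hβ := betaCF_ne_zero hirr (k + 1)
    have hsign : ((-1 : ℝ) ^ (k + 1)) * (-1) ^ (k + 1) = 1 := by
      rw [← mul_pow]; norm_num
    rw [Finset.sum_range_succ, mul_add, eq_sub_of_add_eq (qden_succ_add_gauss_mul_qden hirr k),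
      ← ih, betaCF_succ x (k + 1)]
    have hlast : (-1 : ℝ) ^ (k + 1) * (betaCF x (k + 1) * gauss^[k + 1] x) *
        ((-1) ^ (k + 1) * gauss^[k + 1] x / (betaCF x (k + 1) * gauss^[k + 1] x) ^ 2) =
          (betaCF x (k + 1))⁻¹ := by
      calc _ = ((-1 : ℝ) ^ (k + 1) * (-1) ^ (k + 1)) *
            ((betaCF x (k + 1) * gauss^[k + 1] x) * gauss^[k + 1] x /
              (betaCF x (k + 1) * gauss^[k + 1] x) ^ 2) := by ring
        _ = _ := by rw [hsign]; field_simp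
    rw [hlast]
    ring

end
end

section
/- Let k ≥ 4 be an even integer, let φ_k(z) = ∑_{n=1}^∞ (σ_{k−1}(n)/n^{k+1})·e^{2πinz} for z ∈ ℍ, and let C_k = −(k!·2k)/((2πi)^{k+1}·B_k), where B_k is the k-th Bernoulli number. Then for every α ∈ ℍ there exist a polynomial P ∈ ℂ[X] of degree at most k+1 and a polynomial Q ∈ ℂ[X,Y] of total degree at most k+1 (both depending on k and α) such that for all τ ∈ ℍ: φ_k(τ) = τ^{k+2}·φ_k(−1/τ) − (k/C_k)·τ·Log(τ) + P(τ) + ∫_α^τ Q(t,τ)·φ_k(−1/t) dt, where the integral is taken along the line segment from α to τ in ℍ. -/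
open Real Complex

noncomputable section

/-- The divisor-power function `σ_k(n) = ∑_{d ∣ n} d^k`. -/
def sigmak (k n : ℕ) : ℕ := ∑ d ∈ n.divisors, d ^ k

/-- `φ_k(z) = ∑_{n=1}^∞ σ_{k−1}(n)/n^{k+1} · e^{2πinz}`. -/
def phik (k : ℕ) (z : ℂ) : ℂ :=
  ∑' n : ℕ, (sigmak (k - 1) (n + 1) : ℂ) / ((n : ℂ) + 1) ^ (k + 1) *
    Complex.exp (2 * (Real.pi : ℂ) * Complex.I * ((n : ℂ) + 1) * z)

/-- `C_k = −(k!·2k)/((2πi)^{k+1}·B_k)`, with `B_k` the `k`-th Bernoulli number. -/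
def Ck (k : ℕ) : ℂ :=
  -((Nat.factorial k : ℂ) * 2 * (k : ℂ)) /
    ((2 * (Real.pi : ℂ) * Complex.I) ^ (k + 1) * ((bernoulli k : ℚ) : ℂ))

lemma isOpen_im_pos : IsOpen {z : ℂ | 0 < z.im} := UpperHalfPlane.isOpen_upperHalfPlaneSet

lemma convex_im_pos : Convex ℝ {z : ℂ | 0 < z.im} := convex_halfSpace_im_gt 0

lemma ne_zero_of_im_pos {z : ℂ} (hz : 0 < z.im) : z ≠ 0 := by
  rintro rfl
  simp at hz

lemma im_neg_one_div_pos {z : ℂ} (hz : 0 < z.im) : 0 < (-1 / z).im := by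
  have h := UpperHalfPlane.im_inv_neg_coe_pos ⟨z, hz⟩
  rwa [UpperHalfPlane.coe_mk, inv_neg, inv_eq_one_div, ← neg_div] at h

lemma hasDerivAt_neg_one_div {z : ℂ} (hz : z ≠ 0) :
    HasDerivAt (fun w : ℂ => -1 / w) (z ^ 2)⁻¹ z := by
  have h := (hasDerivAt_inv hz).neg
  simp only [neg_neg] at h
  convert! h using 1
  ext w
  simp [neg_div]

lemma HasDerivAt.comp_neg_one_div {f : ℂ → ℂ} {f' z : ℂ} (hz : z ≠ 0)
    (hf : HasDerivAt f f' (-1 / z)) :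
    HasDerivAt (fun w => f (-1 / w)) (f' * (z ^ 2)⁻¹) z :=
  hf.comp z (hasDerivAt_neg_one_div hz)

lemma iteratedDeriv_id_mul {g : ℂ → ℂ} {n : ℕ} {x : ℂ}
    (hg : ContDiffAt ℂ ((n + 1 : ℕ) : ℕ∞) g x) :
    iteratedDeriv (n + 1) (fun z => z * g z) x =
      x * iteratedDeriv (n + 1) g x + (n + 1) * iteratedDeriv n g x := by
  rw [iteratedDeriv_fun_mul (f := fun z => z) contDiffAt_id hg, Finset.sum_range_succ', Finset.sum_range_succ']
  rw [Finset.sum_eq_zero]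
  · simp [iteratedDeriv_fun_id]
    ring
  · intro i _
    simp [iteratedDeriv_fun_id]

/-- A family of functions on the upper half-plane, each the derivative of the preceding one. -/
def IsDerivChain (F : ℕ → ℂ → ℂ) : Prop :=
  ∀ j (z : ℂ), 0 < z.im → HasDerivAt (F j) (F (j + 1) z) z

lemma IsDerivChain.iteratedDeriv_eq {F : ℕ → ℂ → ℂ} (hF : IsDerivChain F) (m n : ℕ)
    {z : ℂ} (hz : 0 < z.im) : iteratedDeriv n (F m) z = F (m + n) z := by
  induction n generalizing z with
  | zero => simp
  | succ n ih =>
    have h : Set.EqOn (iteratedDeriv n (F m)) (F (m + n)) {z : ℂ | 0 < z.im} := fun w hw => ih hw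
    rw [iteratedDeriv_succ, (h.eventuallyEq_of_mem (isOpen_im_pos.mem_nhds hz)).deriv_eq,
      (hF _ z hz).deriv]
    rfl

lemma IsDerivChain.differentiableOn {F : ℕ → ℂ → ℂ} (hF : IsDerivChain F) (m : ℕ) :
    DifferentiableOn ℂ (F m) {z : ℂ | 0 < z.im} :=
  fun z hz => (hF m z hz).differentiableAt.differentiableWithinAt

lemma IsDerivChain.differentiableOn_pow_mul_comp {F : ℕ → ℂ → ℂ} (hF : IsDerivChain F) (m n : ℕ) :
    DifferentiableOn ℂ (fun z => z ^ n * F m (-1 / z)) {z : ℂ | 0 < z.im} :=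
  fun _ hz => ((differentiableAt_id.pow n).mul ((hF m _ (im_neg_one_div_pos hz)).comp_neg_one_div
    (ne_zero_of_im_pos hz)).differentiableAt).differentiableWithinAt

/-- Bol's identity for the inversion `z ↦ -1/z`. -/
lemma IsDerivChain.bol {F : ℕ → ℂ → ℂ} (hF : IsDerivChain F) (m n : ℕ) {z : ℂ} (hz : 0 < z.im) :
    iteratedDeriv (n + 1) (fun w => w ^ n * F m (-1 / w)) z =
      (z ^ (n + 2))⁻¹ * F (m + n + 1) (-1 / z) := by
  induction n generalizing z with
  | zero =>
    simp only [pow_zero, one_mul, zero_add, iteratedDeriv_one, add_zero]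
    rw [((hF m _ (im_neg_one_div_pos hz)).comp_neg_one_div (ne_zero_of_im_pos hz)).deriv, mul_comm]
  | succ n ih =>
    have h0 := ne_zero_of_im_pos hz
    have hfun : (fun w => w ^ (n + 1) * F m (-1 / w)) =
        fun w => w * (w ^ n * F m (-1 / w)) := by
      ext w
      ring
    have hev : iteratedDeriv (n + 1) (fun w => w ^ n * F m (-1 / w)) =ᶠ[nhds z]
        fun w => (w ^ (n + 2))⁻¹ * F (m + n + 1) (-1 / w) :=
      Filter.eventuallyEq_of_mem (isOpen_im_pos.mem_nhds hz) fun w hw => ih hw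
    have hd := ((hasDerivAt_pow (n + 2) z).fun_inv (pow_ne_zero _ h0)).fun_mul
      ((hF (m + n + 1) _ (im_neg_one_div_pos hz)).comp_neg_one_div h0)
    rw [hfun, iteratedDeriv_id_mul (((hF.differentiableOn_pow_mul_comp m n).contDiffOn
      isOpen_im_pos).contDiffAt (isOpen_im_pos.mem_nhds hz)), iteratedDeriv_succ, hev.deriv_eq,
      hev.eq_of_nhds, hd.deriv]
    rw [show m + (n + 1) + 1 = m + n + 1 + 1 by ring]
    push_cast
    field_simp
    ring

lemma exists_polynomial_derivative_eq (P : Polynomial ℂ) {d : ℕ} (hP : P.natDegree ≤ d) :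
    ∃ R : Polynomial ℂ, R.natDegree ≤ d + 1 ∧ R.derivative = P := by
  refine ⟨∑ i ∈ Finset.range (d + 1), Polynomial.C (P.coeff i / (i + 1)) * Polynomial.X ^ (i + 1),
    ?_, ?_⟩
  · refine Polynomial.natDegree_sum_le_of_forall_le _ _ fun i hi => ?_
    exact (Polynomial.natDegree_C_mul_X_pow_le _ _).trans (by simpa [Nat.lt_succ_iff] using hi)
  · conv_rhs => rw [P.as_sum_range_C_mul_X_pow' (Nat.lt_succ_of_le hP)]
    rw [Polynomial.derivative_sum]
    refine Finset.sum_congr rfl fun i _ => ?_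
    rw [Polynomial.derivative_C_mul_X_pow]
    have : ((i : ℂ) + 1) ≠ 0 := Nat.cast_add_one_ne_zero i
    simp [this]

lemma exists_polynomial_of_hasDerivAt {g : ℂ → ℂ} {P : Polynomial ℂ} {d : ℕ}
    (hP : P.natDegree ≤ d) (hg : ∀ z : ℂ, 0 < z.im → HasDerivAt g (P.eval z) z) :
    ∃ R : Polynomial ℂ, R.natDegree ≤ d + 1 ∧ ∀ z : ℂ, 0 < z.im → g z = R.eval z := by
  obtain ⟨R, hR, hRP⟩ := exists_polynomial_derivative_eq P hP
  obtain ⟨a, ha⟩ := isOpen_im_pos.exists_eq_add_of_deriv_eq (f := g) (g := fun z => R.eval z)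
    convex_im_pos.isPreconnected
    (fun z hz => (hg z hz).differentiableAt.differentiableWithinAt)
    (R.differentiable.differentiableOn)
    (fun z hz => by rw [(hg z hz).deriv, Polynomial.deriv, hRP])
  refine ⟨R + Polynomial.C a, ?_, fun z hz => by simpa using ha hz⟩
  rwa [Polynomial.natDegree_add_C]

lemma exists_polynomial_of_iteratedDeriv_eq_const {g : ℂ → ℂ} {c : ℂ} {n : ℕ}
    (hg : DifferentiableOn ℂ g {z : ℂ | 0 < z.im})
    (h : ∀ z : ℂ, 0 < z.im → iteratedDeriv n g z = c) :
    ∃ R : Polynomial ℂ, R.natDegree ≤ n ∧ ∀ z : ℂ, 0 < z.im → g z = R.eval z := by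
  induction n generalizing g with
  | zero => exact ⟨Polynomial.C c, by simp, fun z hz => by simpa using h z hz⟩
  | succ n ih =>
    obtain ⟨P, hP, hPg⟩ := ih (hg.deriv isOpen_im_pos)
      (fun z hz => by rw [← iteratedDeriv_succ']; exact h z hz)
    refine exists_polynomial_of_hasDerivAt hP fun z hz => ?_
    rw [← hPg z hz]
    exact (hg.differentiableAt (isOpen_im_pos.mem_nhds hz)).hasDerivAt

/-- The `j`-th derivative of `φ_k`, as a series. -/
def phikDeriv (k j : ℕ) (z : ℂ) : ℂ :=
  ∑' n : ℕ, (sigmak (k - 1) (n + 1) : ℂ) / ((n : ℂ) + 1) ^ (k + 1) *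
    (2 * (Real.pi : ℂ) * Complex.I * ((n : ℂ) + 1)) ^ j *
    Complex.exp (2 * (Real.pi : ℂ) * Complex.I * ((n : ℂ) + 1) * z)

lemma phikDeriv_zero (k : ℕ) : phikDeriv k 0 = phik k := by
  ext z
  simp [phikDeriv, phik]

lemma sigmak_le (k n : ℕ) : sigmak k n ≤ n ^ (k + 1) :=
  ArithmeticFunction.sigma_le_pow_succ k n

lemma norm_phikDeriv_term_le {k : ℕ} (hk : 1 ≤ k) (j n : ℕ) {δ : ℝ} {z : ℂ} (hz : δ ≤ z.im) :
    ‖(sigmak (k - 1) (n + 1) : ℂ) / ((n : ℂ) + 1) ^ (k + 1) *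
      (2 * (Real.pi : ℂ) * Complex.I * ((n : ℂ) + 1)) ^ j *
      Complex.exp (2 * (Real.pi : ℂ) * Complex.I * ((n : ℂ) + 1) * z)‖ ≤
    (2 * Real.pi) ^ j * (((n + 1 : ℕ) : ℝ) ^ j * Real.exp (-(2 * Real.pi * δ)) ^ (n + 1)) := by
  have hn : ‖(n : ℂ) + 1‖ = (n : ℝ) + 1 := by
    rw [← Nat.cast_succ, Complex.norm_natCast, Nat.cast_succ]
  have hexp : ‖Complex.exp (2 * (Real.pi : ℂ) * Complex.I * ((n : ℂ) + 1) * z)‖ ≤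
      Real.exp (-(2 * Real.pi * δ)) ^ (n + 1) := by
    rw [Complex.norm_exp, ← Real.exp_nat_mul, Real.exp_le_exp]
    have : (2 * (Real.pi : ℂ) * Complex.I * ((n : ℂ) + 1) * z).re =
        -(((n : ℝ) + 1) * (2 * Real.pi * z.im)) := by
      simp
      ring
    rw [this]
    push_cast
    rw [mul_neg]
    have := Real.pi_pos
    gcongr
  have hs : ‖(sigmak (k - 1) (n + 1) : ℂ) / ((n : ℂ) + 1) ^ (k + 1)‖ ≤ 1 := by
    rw [norm_div, norm_pow, hn, Complex.norm_natCast]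
    apply div_le_one_of_le₀ _ (by positivity)
    have h1 : (sigmak (k - 1) (n + 1) : ℝ) ≤ ((n : ℝ) + 1) ^ k := by
      have := sigmak_le (k - 1) (n + 1)
      rw [Nat.sub_add_cancel hk] at this
      exact_mod_cast this
    exact h1.trans (pow_le_pow_right₀ (by simp) (Nat.le_succ k))
  rw [norm_mul, norm_mul, norm_pow, norm_mul, hn]
  have h2 : ‖2 * (Real.pi : ℂ) * Complex.I‖ = 2 * Real.pi := by
    simp [abs_of_pos Real.pi_pos]
  rw [h2, mul_pow]
  push_cast
  calc _ ≤ 1 * ((2 * Real.pi) ^ j * ((n : ℝ) + 1) ^ j) * Real.exp (-(2 * Real.pi * δ)) ^ (n + 1) := by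
        have := Real.pi_pos
        gcongr
    _ = _ := by ring

lemma summable_phikDeriv_bound (j : ℕ) {δ : ℝ} (hδ : 0 < δ) :
    Summable fun n : ℕ => (2 * Real.pi) ^ j *
      (((n + 1 : ℕ) : ℝ) ^ j * Real.exp (-(2 * Real.pi * δ)) ^ (n + 1)) := by
  have h := summable_pow_mul_geometric_of_norm_lt_one (R := ℝ) j
    (r := Real.exp (-(2 * Real.pi * δ))) (by
      have := Real.pi_pos
      rw [Real.norm_of_nonneg (Real.exp_nonneg _), Real.exp_lt_one_iff, neg_lt_zero]
      positivity)
  exact ((summable_nat_add_iff 1).2 h).mul_left _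

lemma isDerivChain_phikDeriv {k : ℕ} (hk : 1 ≤ k) : IsDerivChain (phikDeriv k) := by
  intro j z hz
  have hδ : 0 < z.im / 2 := by positivity
  have hz' : z ∈ {w : ℂ | z.im / 2 < w.im} := by
    simp only [Set.mem_ofPred_eq]
    linarith
  refine hasDerivAt_tsum_of_isPreconnected (summable_phikDeriv_bound (j + 1) hδ)
    (t := {w : ℂ | z.im / 2 < w.im}) (isOpen_lt continuous_const Complex.continuous_im)
    (convex_halfSpace_im_gt _).isPreconnected (fun n w _ => ?_)
    (fun n w hw => norm_phikDeriv_term_le hk (j + 1) n (le_of_lt hw)) hz'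
    (Summable.of_norm_bounded (summable_phikDeriv_bound j hδ)
      fun n => norm_phikDeriv_term_le hk j n (le_of_lt hz')) hz'
  have h := (((hasDerivAt_id w).const_mul
    (2 * (Real.pi : ℂ) * Complex.I * ((n : ℂ) + 1))).cexp).const_mul
    ((sigmak (k - 1) (n + 1) : ℂ) / ((n : ℂ) + 1) ^ (k + 1) *
    (2 * (Real.pi : ℂ) * Complex.I * ((n : ℂ) + 1)) ^ j)
  convert! h using 1
  simp only [id]
  ring

lemma bernoulli_ne_zero_of_even {k : ℕ} (hk : 2 ≤ k) (hke : Even k) : bernoulli k ≠ 0 := by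
  obtain ⟨m, rfl⟩ := hke
  rw [← two_mul] at *
  intro h
  have hz := riemannZeta_two_mul_nat (k := m) (by omega)
  rw [h] at hz
  refine riemannZeta_ne_zero_of_one_lt_re (s := 2 * (m : ℂ)) ?_ (by simpa using hz)
  have : (2 : ℝ) ≤ 2 * m := by exact_mod_cast hk
  simp
  linarith

lemma phikDeriv_succ_eq {k : ℕ} (hk : 3 ≤ k) (hke : Even k) (z : UpperHalfPlane) :
    phikDeriv k (k + 1) z =
      ((k : ℂ) / Ck k * (Nat.factorial (k - 1) : ℂ)) * (ModularForm.E hk z - 1) := by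
  rw [EisensteinSeries.q_expansion_bernoulli hk hke z]
  have hB : ((bernoulli k : ℚ) : ℂ) ≠ 0 := by
    exact_mod_cast bernoulli_ne_zero_of_even (by omega) hke
  have hsum : phikDeriv k (k + 1) z = (2 * (Real.pi : ℂ) * Complex.I) ^ (k + 1) *
      ∑' n : ℕ+, (ArithmeticFunction.sigma (k - 1) n : ℂ) *
        Complex.exp (2 * Real.pi * Complex.I * z) ^ ((n : ℕ) : ℤ) := by
    rw [tsum_pnat_eq_tsum_succ (f := fun n : ℕ => (ArithmeticFunction.sigma (k - 1) n : ℂ) *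
        Complex.exp (2 * Real.pi * Complex.I * z) ^ (n : ℤ)), phikDeriv, ← tsum_mul_left]
    refine tsum_congr fun n => ?_
    have hn : (n : ℂ) + 1 ≠ 0 := Nat.cast_add_one_ne_zero n
    rw [zpow_natCast, ← Complex.exp_nat_mul, mul_pow (2 * (Real.pi : ℂ) * Complex.I)]
    rw [show (ArithmeticFunction.sigma (k - 1) (n + 1)) = sigmak (k - 1) (n + 1) from rfl]
    push_cast
    rw [show 2 * (Real.pi : ℂ) * Complex.I * ((n : ℂ) + 1) * z =
      ((n : ℂ) + 1) * (2 * (Real.pi : ℂ) * Complex.I * z) by ring]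
    field_simp
  rw [hsum, Ck]
  have hfac : (Nat.factorial k : ℂ) = k * (Nat.factorial (k - 1) : ℂ) := by
    rw [← Nat.mul_factorial_pred (by omega : k ≠ 0)]
    push_cast
    rfl
  have hk0 : (k : ℂ) ≠ 0 := by
    exact_mod_cast (by omega : k ≠ 0)
  have hf0 : (Nat.factorial (k - 1) : ℂ) ≠ 0 := by
    exact_mod_cast Nat.factorial_ne_zero _
  rw [hfac]
  have hpi := Complex.two_pi_I_ne_zero
  field_simp
  ring

lemma E_neg_one_div {k : ℕ} (hk : 3 ≤ k) {z : ℂ} (hz : 0 < z.im) :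
    (z ^ k)⁻¹ * ModularForm.E hk ⟨-1 / z, im_neg_one_div_pos hz⟩ = ModularForm.E hk ⟨z, hz⟩ := by
  have h := congrFun (SlashInvariantForm.slash_action_eqn (ModularForm.E hk)
    (ModularGroup.S : Matrix.GeneralLinearGroup (Fin 2) ℝ) ⟨_, rfl⟩) ⟨z, hz⟩
  have h2 := SlashInvariantForm.slash_S_apply (ModularForm.E hk) k ⟨z, hz⟩
  rw [← h, ← ModularForm.SL_slash, h2, zpow_neg, zpow_natCast, mul_comm]
  congr 3
  rw [inv_neg, inv_eq_one_div, ← neg_div]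

lemma iteratedDeriv_const_mul_inv (c : ℂ) (n : ℕ) (z : ℂ) :
    iteratedDeriv n (fun w => c * w⁻¹) z =
      c * ((-1) ^ n * (Nat.factorial n : ℂ) * (z ^ (n + 1))⁻¹) := by
  rw [iteratedDeriv_const_mul_field, iteratedDeriv_eq_iterate, iter_deriv_inv,
    show (-1 - (n : ℤ)) = -((n + 1 : ℕ) : ℤ) by push_cast; ring, zpow_neg, zpow_natCast]

/-- The second derivative of `φ_k` satisfies the functional equation of an Eichler integral. -/
lemma exists_polynomial_phikDeriv_two {k : ℕ} (hk : 4 ≤ k) (hke : Even k) :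
    ∃ R : Polynomial ℂ, R.natDegree ≤ k - 1 ∧ ∀ z : ℂ, 0 < z.im →
      phikDeriv k 2 z - z ^ (k - 2) * phikDeriv k 2 (-1 / z) + (k : ℂ) / Ck k * z⁻¹ = R.eval z := by
  have hF := isDerivChain_phikDeriv (k := k) (by omega)
  have h1 := hF.differentiableOn 2
  have h2 := hF.differentiableOn_pow_mul_comp 2 (k - 2)
  have h3 : DifferentiableOn ℂ (fun z : ℂ => (k : ℂ) / Ck k * z⁻¹) {z : ℂ | 0 < z.im} :=
    fun z hz => ((differentiableAt_inv (ne_zero_of_im_pos hz)).const_mul _).differentiableWithinAt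
  refine exists_polynomial_of_iteratedDeriv_eq_const
    (c := -((k : ℂ) / Ck k * (Nat.factorial (k - 1) : ℂ))) ((h1.sub h2).add h3) fun z hz => ?_
  have hn := isOpen_im_pos.mem_nhds hz
  have hc {f : ℂ → ℂ} (hf : DifferentiableOn ℂ f {z : ℂ | 0 < z.im}) :
      ContDiffAt ℂ ((k - 1 : ℕ) : ℕ∞) f z := (hf.contDiffOn isOpen_im_pos).contDiffAt hn
  have hb := hF.bol 2 (k - 2) hz
  rw [show k - 2 + 1 = k - 1 by omega, show k - 2 + 2 = k by omega,
    show 2 + (k - 2) + 1 = k + 1 by omega] at hb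
  have hodd : Odd (k - 1) := Nat.Even.sub_odd (by omega) hke odd_one
  change iteratedDeriv (k - 1) ((phikDeriv k 2 - fun z => z ^ (k - 2) * phikDeriv k 2 (-1 / z)) +
    fun z => (k : ℂ) / Ck k * z⁻¹) z = _
  rw [iteratedDeriv_add (hc (h1.sub h2)) (hc h3), iteratedDeriv_sub (hc h1) (hc h2), hb,
    hF.iteratedDeriv_eq 2 _ hz, show 2 + (k - 1) = k + 1 by omega, iteratedDeriv_const_mul_inv,
    hodd.neg_one_pow, show k - 1 + 1 = k by omega]
  have e1 := phikDeriv_succ_eq (by omega) hke ⟨z, hz⟩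
  have e2 := phikDeriv_succ_eq (by omega) hke ⟨-1 / z, im_neg_one_div_pos hz⟩
  have e3 := E_neg_one_div (k := k) (by omega) hz
  rw [UpperHalfPlane.coe_mk] at e1 e2
  rw [e1, e2, ← e3]
  ring

lemma segment_integral_eq_sub {g G : ℂ → ℂ} (hG : ∀ z : ℂ, 0 < z.im → HasDerivAt G (g z) z)
    (hg : ContinuousOn g {z : ℂ | 0 < z.im}) {a b : ℂ} (ha : 0 < a.im) (hb : 0 < b.im) :
    (IntervalIntegrable (fun s : ℝ => (b - a) * g (a + (s : ℂ) * (b - a)))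
      MeasureTheory.volume 0 1) ∧
    ∫ s in (0 : ℝ)..1, (b - a) * g (a + (s : ℂ) * (b - a)) = G b - G a := by
  have hmem : ∀ s ∈ Set.uIcc (0 : ℝ) 1, 0 < (a + (s : ℂ) * (b - a)).im := by
    intro s hs
    rw [Set.uIcc_of_le zero_le_one] at hs
    have := convex_im_pos.add_smul_sub_mem ha hb hs
    simpa using this
  have hcont : ContinuousOn (fun s : ℝ => (b - a) * g (a + (s : ℂ) * (b - a)))
      (Set.uIcc (0 : ℝ) 1) :=
    continuousOn_const.mul (hg.comp (by fun_prop) fun s hs => hmem s hs)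
  refine ⟨hcont.intervalIntegrable, ?_⟩
  have hderiv : ∀ s ∈ Set.uIcc (0 : ℝ) 1, HasDerivAt (fun s : ℝ => G (a + (s : ℂ) * (b - a)))
      ((b - a) * g (a + (s : ℂ) * (b - a))) s := by
    intro s hs
    have hl : HasDerivAt (fun s : ℂ => a + s * (b - a)) (b - a) (s : ℂ) := by
      simpa using ((hasDerivAt_id (s : ℂ)).mul_const (b - a)).const_add a
    have := ((hG _ (hmem s hs)).comp (s : ℂ) hl).comp_ofReal
    rwa [mul_comm] at this
  rw [intervalIntegral.integral_eq_sub_of_hasDerivAt hderiv hcont.intervalIntegrable]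
  simp

lemma exists_primitive_im_pos {g : ℂ → ℂ} (hg : DifferentiableOn ℂ g {z : ℂ | 0 < z.im}) :
    ∃ G : ℂ → ℂ, ∀ z : ℂ, 0 < z.im → HasDerivAt G (g z) z := by
  obtain ⟨G, hG⟩ := convex_im_pos.exists_forall_hasDerivWithinAt hg
  exact ⟨G, fun z hz => (hG z hz).hasDerivAt (isOpen_im_pos.mem_nhds hz)⟩

/-- The integral kernel `Q(t,τ) = k(k+1)·τ·t^k − (k+1)(k+2)·t^{k+1}`. -/
def phikKernel (k : ℕ) : MvPolynomial (Fin 2) ℂ :=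
  MvPolynomial.C ((k : ℂ) * (k + 1)) * (MvPolynomial.X 1 * MvPolynomial.X 0 ^ k) -
    MvPolynomial.C (((k : ℂ) + 1) * (k + 2)) * MvPolynomial.X 0 ^ (k + 1)

lemma totalDegree_phikKernel (k : ℕ) : (phikKernel k).totalDegree ≤ k + 1 := by
  refine (MvPolynomial.totalDegree_sub _ _).trans (max_le ?_ ?_)
  · refine (MvPolynomial.totalDegree_mul _ _).trans ?_
    rw [MvPolynomial.totalDegree_C, zero_add]
    refine (MvPolynomial.totalDegree_mul _ _).trans ?_
    rw [MvPolynomial.totalDegree_X, MvPolynomial.totalDegree_X_pow, add_comm]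
  · refine (MvPolynomial.totalDegree_mul _ _).trans ?_
    rw [MvPolynomial.totalDegree_C, zero_add, MvPolynomial.totalDegree_X_pow]

lemma eval_phikKernel (k : ℕ) (t τ : ℂ) :
    MvPolynomial.eval ![t, τ] (phikKernel k) =
      (k : ℂ) * (k + 1) * (τ * t ^ k) - ((k : ℂ) + 1) * (k + 2) * t ^ (k + 1) := by
  simp [phikKernel]

/-- Functional equation for `φ_k`, `k ≥ 4` even: for every `α ∈ ℍ` there are a polynomial
`P ∈ ℂ[X]` of degree ≤ k+1 and a two-variable polynomial `Q` of total degree ≤ k+1 with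
`φ_k(τ) = τ^{k+2}·φ_k(−1/τ) − (k/C_k)·τ·Log τ + P(τ) + ∫_α^τ Q(t,τ)·φ_k(−1/t) dt` for all
`τ ∈ ℍ`, the integral being along the segment from `α` to `τ` (parametrized by
`t = α + s(τ−α)`, `s ∈ [0,1]`). -/
theorem phik_functional_equation (k : ℕ) (hk : 4 ≤ k) (hke : Even k)
    (α : ℂ) (hα : 0 < α.im) :
    ∃ P : Polynomial ℂ, ∃ Q : MvPolynomial (Fin 2) ℂ,
      P.degree ≤ ((k + 1 : ℕ) : WithBot ℕ) ∧ Q.totalDegree ≤ k + 1 ∧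
      ∀ τ : ℂ, 0 < τ.im →
        phik k τ = τ ^ (k + 2) * phik k (-1 / τ)
          - ((k : ℂ) / Ck k) * τ * Complex.log τ
          + P.eval τ
          + ∫ s in (0 : ℝ)..1, (τ - α) *
              MvPolynomial.eval ![α + (s : ℂ) * (τ - α), τ] Q *
              phik k (-1 / (α + (s : ℂ) * (τ - α))) := by
  have hF := isDerivChain_phikDeriv (k := k) (by omega)
  have hM := hF.differentiableOn_pow_mul_comp 0 (k + 1)
  have hN := hF.differentiableOn_pow_mul_comp 0 k
  obtain ⟨M, hM'⟩ := exists_primitive_im_pos hM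
  obtain ⟨N, hN'⟩ := exists_primitive_im_pos hN
  have hint : ∀ τ : ℂ, 0 < τ.im → ∫ s in (0 : ℝ)..1, (τ - α) *
      MvPolynomial.eval ![α + (s : ℂ) * (τ - α), τ] (phikKernel k) *
        phik k (-1 / (α + (s : ℂ) * (τ - α))) =
      (k : ℂ) * (k + 1) * τ * (N τ - N α) - ((k : ℂ) + 1) * (k + 2) * (M τ - M α) := by
    intro τ hτ
    obtain ⟨iM, eM⟩ := segment_integral_eq_sub hM' hM.continuousOn hα hτ
    obtain ⟨iN, eN⟩ := segment_integral_eq_sub hN' hN.continuousOn hα hτ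
    rw [← eM, ← eN, ← intervalIntegral.integral_const_mul, ← intervalIntegral.integral_const_mul,
      ← intervalIntegral.integral_sub (iN.const_mul _) (iM.const_mul _)]
    refine intervalIntegral.integral_congr fun s _ => ?_
    simp only [eval_phikKernel, phikDeriv_zero]
    ring
  obtain ⟨R, hR, hR'⟩ := exists_polynomial_phikDeriv_two hk hke
  set K : ℂ := (k : ℂ) / Ck k
  have hW1 : ∀ z : ℂ, 0 < z.im → HasDerivAt
      (fun z => phikDeriv k 1 z + k * (z ^ (k + 1) * phikDeriv k 0 (-1 / z)) -
        z ^ k * phikDeriv k 1 (-1 / z) + K * (Complex.log z + 1) - k * (k + 1) * (N z - N α))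
      (R.eval z) z := by
    intro z hz
    have h0 := ne_zero_of_im_pos hz
    have hz' := im_neg_one_div_pos hz
    have hlog := Complex.hasDerivAt_log (Complex.mem_slitPlane_iff.2 (Or.inr hz.ne'))
    have d1 := ((hasDerivAt_pow (k + 1) z).fun_mul
      ((hF 0 _ hz').comp_neg_one_div h0)).const_mul (k : ℂ)
    have d2 := (hasDerivAt_pow k z).fun_mul ((hF 1 _ hz').comp_neg_one_div h0)
    have d3 := (hlog.add_const 1).const_mul K
    have d4 := ((hN' z hz).sub_const (N α)).const_mul ((k : ℂ) * (k + 1))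
    refine ((((hF 1 z hz).fun_add d1).fun_sub d2).fun_add d3 |>.fun_sub d4).congr_deriv ?_
    rw [← hR' z hz]
    obtain ⟨m, rfl⟩ : ∃ m, k = m + 2 := ⟨k - 2, by omega⟩
    simp only [Nat.add_sub_cancel, show m + 2 - 1 = m + 1 by omega]
    push_cast
    field_simp
    ring
  obtain ⟨R₁, hR₁, hR₁'⟩ := exists_polynomial_of_hasDerivAt hR hW1
  have hW : ∀ z : ℂ, 0 < z.im → HasDerivAt
      (fun z => phikDeriv k 0 z - z ^ (k + 2) * phikDeriv k 0 (-1 / z) + K * (z * Complex.log z) -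
        ((k : ℂ) * (k + 1) * (z * (N z - N α)) - ((k : ℂ) + 1) * (k + 2) * (M z - M α)))
      (R₁.eval z) z := by
    intro z hz
    have h0 := ne_zero_of_im_pos hz
    have hz' := im_neg_one_div_pos hz
    have hlog := Complex.hasDerivAt_log (Complex.mem_slitPlane_iff.2 (Or.inr hz.ne'))
    have d1 := (hasDerivAt_pow (k + 2) z).fun_mul ((hF 0 _ hz').comp_neg_one_div h0)
    have d2 := ((hasDerivAt_id' z).fun_mul hlog).const_mul K
    have d3 := ((hasDerivAt_id' z).fun_mul ((hN' z hz).sub_const (N α))).const_mul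
      ((k : ℂ) * (k + 1))
    have d4 := ((hM' z hz).sub_const (M α)).const_mul (((k : ℂ) + 1) * (k + 2))
    refine ((((hF 0 z hz).fun_sub d1).fun_add d2).fun_sub (d3.fun_sub d4)).congr_deriv ?_
    rw [← hR₁' z hz]
    simp only [show k + 2 - 1 = k + 1 by omega]
    push_cast
    field_simp
    ring
  obtain ⟨P, hP, hP'⟩ := exists_polynomial_of_hasDerivAt hR₁ hW
  refine ⟨P, phikKernel k, ?_, totalDegree_phikKernel k, fun τ hτ => ?_⟩
  · refine Polynomial.degree_le_of_natDegree_le (hP.trans (by omega))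
  · rw [hint τ hτ, ← hP' τ hτ, phikDeriv_zero]
    ring

end
end
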